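/- arXiv:math/0609769 — 3 statements merged into one kernel-verified Lean document; each statement's English description precedes it below -/
import Mathlib

section
/- Let Π be a finite group and φ : Π → Π a group automorphism. Then the number of orbits of the φ-conjugation action of Π on itself (the action γ • x = φ(γ)·x·γ⁻¹) equals the number of functions χ : Π → ℂ that are characters of irreducible finite-dimensional complex representations of Π and satisfy χ ∘ φ = χ. -/
/-- A bundled irreducible finite-dimensional complex representation of a group `G`. -/
structure IrrRep (G : Type) [Group G] where
  carrier : Type
  [isAddCommGroup : AddCommGroup carrier]
  [isModule : Module ℂ carrier]
  [isFiniteDimensional : FiniteDimensional ℂ carrier]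
  ρ : G →* (carrier →ₗ[ℂ] carrier)
  nontrivial : ∃ v : carrier, v ≠ 0
  irreducible : ∀ W : Submodule ℂ carrier,
    (∀ g : G, ∀ v ∈ W, ρ g v ∈ W) → W = ⊥ ∨ W = ⊤

attribute [instance] IrrRep.isAddCommGroup IrrRep.isModule IrrRep.isFiniteDimensional

/-- The character of a bundled representation. -/
noncomputable def IrrRep.char {G : Type} [Group G] (ρ : IrrRep G) : G → ℂ :=
  fun g => LinearMap.trace ℂ ρ.carrier (ρ.ρ g)

theorem aux_trace_perm {ι V : Type*} [Finite ι] [AddCommGroup V] [Module ℂ V]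
    (b : Module.Basis ι ℂ V) (T : V →ₗ[ℂ] V) (s : ι → ι) (h : ∀ i, T (b i) = b (s i)) :
    LinearMap.trace ℂ V T = (Nat.card {i // s i = i} : ℂ) := by
  classical
  have := Fintype.ofFinite ι
  rw [LinearMap.trace_eq_matrix_trace ℂ b, Matrix.trace]
  simp only [Matrix.diag, LinearMap.toMatrix_apply, h, Module.Basis.repr_self,
    Finsupp.single_apply]
  rw [Finset.sum_boole, Nat.card_eq_fintype_card, Fintype.card_subtype]

/-- The irreducible representation attached to a simple left ideal. -/
noncomputable def simpleIrr (P : Type) [Group P] [Finite P]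
    (S : Submodule (MonoidAlgebra ℂ P) (MonoidAlgebra ℂ P))
    (hS : IsSimpleModule (MonoidAlgebra ℂ P) S) : IrrRep P where
  carrier := S
  isFiniteDimensional := by
    have : Module.Finite ℂ (MonoidAlgebra ℂ P) := inferInstance
    exact (inferInstance : FiniteDimensional ℂ (S.restrictScalars ℂ))
  ρ := Representation.ofModule' (k := ℂ) (G := P) S
  nontrivial := by
    have := IsSimpleModule.nontrivial (MonoidAlgebra ℂ P) S
    exact exists_ne 0
  irreducible := by
    intro W hW
    have key : ∀ (a : MonoidAlgebra ℂ P) (v : S), v ∈ W → a • v ∈ W := by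
      intro a v hv
      induction a using MonoidAlgebra.induction_on with
      | of g => exact hW g v hv
      | add a b ha hb => rw [add_smul]; exact W.add_mem ha hb
      | smul r a ha => rw [smul_assoc]; exact W.smul_mem r ha
    let W' : Submodule (MonoidAlgebra ℂ P) S :=
      { W with smul_mem' := fun a v hv => key a v hv }
    have := eq_bot_or_eq_top W'
    rcases this with h | h
    · left
      ext v
      have : v ∈ W' ↔ v ∈ (⊥ : Submodule (MonoidAlgebra ℂ P) S) := by rw [h]
      exact this
    · right
      ext v
      have : v ∈ W' ↔ v ∈ (⊤ : Submodule (MonoidAlgebra ℂ P) S) := by rw [h]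
      exact this

theorem aux_scalar {P : Type} [Group P] [Fintype P] (w : P → ℂ)
    (hw : ∀ g h, w (h * g * h⁻¹) = w g) (R : IrrRep P)
    (h0 : ∑ g, w g * R.char g = 0) : ∑ g, w g • R.ρ g = 0 := by
  have : Nontrivial R.carrier := by
    obtain ⟨v, hv⟩ := R.nontrivial
    exact ⟨v, 0, hv⟩
  set z : Module.End ℂ R.carrier := ∑ g, w g • R.ρ g with hz
  have hcomm : ∀ h, R.ρ h * z = z * R.ρ h := by
    intro h
    rw [hz, Finset.mul_sum, Finset.sum_mul]
    refine Fintype.sum_equiv (MulAut.conj h).toEquiv _ _ fun g => ?_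
    have : (MulAut.conj h).toEquiv g = h * g * h⁻¹ := rfl
    rw [this, hw, mul_smul_comm, smul_mul_assoc, ← map_mul, ← map_mul]
    simp
  obtain ⟨μ, hμ⟩ := Module.End.exists_eigenvalue z
  have hE := R.irreducible (z.eigenspace μ) (by
    intro g v hv
    rw [Module.End.mem_eigenspace_iff] at hv ⊢
    have := LinearMap.congr_fun (hcomm g) v
    simp only [Module.End.mul_apply] at this
    rw [← this, hv, map_smul])
  have htop := hE.resolve_left hμ
  have hzμ : z = μ • (1 : Module.End ℂ R.carrier) := by
    ext v
    have : v ∈ z.eigenspace μ := by rw [htop]; trivial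
    simpa [Module.End.mem_eigenspace_iff] using this
  have htr : LinearMap.trace ℂ _ z = 0 := by
    rw [← h0, hz, map_sum]
    simp [IrrRep.char]
  rw [hzμ, map_smul, LinearMap.trace_one, smul_eq_mul, mul_eq_zero] at htr
  rcases htr with h | h
  · rw [hzμ, h, zero_smul]
  · exact absurd (Nat.cast_eq_zero.mp h) (Module.finrank_pos (R := ℂ) (M := R.carrier)).ne'

theorem aux_complete {P : Type} [Group P] [Fintype P] (w : P → ℂ)
    (hw : ∀ g h, w (h * g * h⁻¹) = w g)
    (h0 : ∀ R : IrrRep P, ∑ g, w g * R.char g = 0) : w = 0 := by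
  let z : MonoidAlgebra ℂ P := ∑ g, MonoidAlgebra.single g (w g)
  have hz : ∀ v : MonoidAlgebra ℂ P, z * v = 0 := by
    have htop := IsSemisimpleModule.sSup_simples_eq_top (MonoidAlgebra ℂ P) (MonoidAlgebra ℂ P)
    have hS : ∀ S : Submodule (MonoidAlgebra ℂ P) (MonoidAlgebra ℂ P),
        IsSimpleModule (MonoidAlgebra ℂ P) S → ∀ v ∈ S, z * v = 0 := by
      intro S hS v hv
      have := aux_scalar w hw (simpleIrr P S hS) (h0 _)
      have h1 := LinearMap.congr_fun this (⟨v, hv⟩ : S)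
      have h2 := (LinearMap.sum_apply Finset.univ
        (fun g => w g • (simpleIrr P S hS).ρ g) (⟨v, hv⟩ : S)).symm.trans h1
      have h4 : ∀ g, ((w g • (simpleIrr P S hS).ρ g) ⟨v, hv⟩ : S) =
          (MonoidAlgebra.single g (w g) : MonoidAlgebra ℂ P) • (⟨v, hv⟩ : S) := by
        intro g
        change w g • ((MonoidAlgebra.single g (1:ℂ) : MonoidAlgebra ℂ P) • (⟨v, hv⟩ : S)) = _
        rw [← smul_assoc, MonoidAlgebra.smul_single, smul_eq_mul, mul_one]
      have h5 : (∑ g, (w g • (simpleIrr P S hS).ρ g) ⟨v, hv⟩ : S) = z • (⟨v, hv⟩ : S) := by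
        have h7 : (∑ g, (MonoidAlgebra.single g (w g) : MonoidAlgebra ℂ P) • (⟨v, hv⟩ : S)) =
            z • (⟨v, hv⟩ : S) := by
          simp only [z, Finset.sum_smul]
        exact Eq.trans (Finset.sum_congr rfl fun g _ => h4 g) h7
      have h6 : z • (⟨v, hv⟩ : S) = 0 := h5.symm.trans h2
      exact congrArg (fun x : S => (x : MonoidAlgebra ℂ P)) h6
    intro v
    have hv : v ∈ sSup { m : Submodule (MonoidAlgebra ℂ P) (MonoidAlgebra ℂ P) |
        IsSimpleModule (MonoidAlgebra ℂ P) m } := by rw [htop]; trivial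
    rw [sSup_eq_iSup'] at hv
    induction hv using Submodule.iSup_induction' with
    | mem i x hx => exact hS i.1 i.2 x hx
    | zero => simp
    | add x y _ _ hx hy => rw [mul_add, hx, hy, add_zero]
  have h1 : z = 0 := by simpa using hz 1
  classical
  funext g
  have h2 : ∑ g, MonoidAlgebra.single g (w g) = (0 : MonoidAlgebra ℂ P) := h1
  have := congrArg (fun x : MonoidAlgebra ℂ P => x.coeff g) h2
  simpa [Finsupp.single_apply] using this

theorem aux_irr {P : Type} [Group P] (R : IrrRep P) :
    Representation.IsIrreducible (k := ℂ) (V := R.carrier) R.ρ := by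
  obtain ⟨v, hv⟩ := R.nontrivial
  refine { exists_pair_ne := ⟨⊥, ⊤, ?_⟩, eq_bot_or_eq_top := ?_ }
  · intro h
    have h2 := congrArg (fun x : Subrepresentation (A := ℂ) (W := R.carrier) R.ρ => x.toSubmodule) h
    have : v ∈ (⊥ : Submodule ℂ R.carrier) := by
      have h3 : (⊥ : Submodule ℂ R.carrier) = ⊤ := h2
      rw [h3]; trivial
    exact hv (by simpa using this)
  · intro W
    rcases R.irreducible W.toSubmodule (fun g v hv => W.apply_mem_toSubmodule g hv) with h | h
    · left; exact Subrepresentation.toSubmodule_injective h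
    · right; exact Subrepresentation.toSubmodule_injective h

theorem aux_orth {P : Type} [Group P] [Fintype P] (R S : IrrRep P) :
    (R.char ≠ S.char → ∑ g, R.char g * S.char g⁻¹ = 0) ∧
    (∑ g, R.char g * R.char g⁻¹ ≠ 0) := by
  have hne : (Nat.card P : ℂ) ≠ 0 := by simp
  let : Invertible (Nat.card P : ℂ) := invertibleOfNonzero hne
  have := aux_irr R
  have := aux_irr S
  constructor
  · intro h
    have := Representation.char_orthonormal (k := ℂ) (V := R.carrier) (W := S.carrier) R.ρ S.ρ
    rw [if_neg] at this
    · rcases mul_eq_zero.mp this with h | h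
      · exact absurd h (inv_ne_zero hne)
      · exact h
    · rintro ⟨e⟩
      exact h (Representation.char_iso (k := ℂ) (V := S.carrier) (W := R.carrier) e).symm
  · intro h
    have := Representation.char_orthonormal (k := ℂ) (V := R.carrier) (W := R.carrier) R.ρ R.ρ
    rw [if_pos ⟨Representation.Equiv.refl _⟩] at this
    have h' : ∑ g, Representation.character (k := ℂ) (V := R.carrier) R.ρ g *
      Representation.character (k := ℂ) (V := R.carrier) R.ρ g⁻¹ = 0 := h
    rw [h'] at this
    simp at this

theorem aux_card {P : Type} [Group P] [Finite P] (φ : P ≃* P) :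
    Nat.card ↥(Set.range (fun x : P => {y : P | ∃ γ : P, φ γ * x * γ⁻¹ = y})) =
    Nat.card {c : ConjClasses P // ConjClasses.map (φ : P →* P) c = c} := by
  classical
  have := Fintype.ofFinite P
  let act : MulAction P P :=
    { smul := fun γ x => φ γ * x * γ⁻¹
      one_smul := fun x => by change φ 1 * x * 1⁻¹ = x; simp
      mul_smul := fun a b x => by
        change φ (a * b) * x * (a * b)⁻¹ = φ a * (φ b * x * b⁻¹) * a⁻¹
        simp [mul_assoc] }
  have hB := @MulAction.sum_card_fixedBy_eq_card_orbits_mul_card_group P P _ act _ _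
    (Fintype.ofFinite _)
  have h1 : Nat.card ↥(Set.range (fun x : P => {y : P | ∃ γ : P, φ γ * x * γ⁻¹ = y})) =
      Nat.card (Quotient (@MulAction.orbitRel P P _ act)) := by
    refine Nat.card_congr ?_
    refine Equiv.ofBijective (fun s => Quotient.mk _ s.2.choose) ⟨?_, ?_⟩
    · rintro s t h
      have hs := s.2.choose_spec
      have ht := t.2.choose_spec
      apply Subtype.ext
      rw [← hs, ← ht]
      have h := Quotient.exact h
      obtain ⟨γ, hγ⟩ := h
      change φ γ * _ * γ⁻¹ = _ at hγ
      ext y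
      simp only [Set.mem_ofPred_eq]
      constructor
      · rintro ⟨δ, rfl⟩
        refine ⟨δ * γ, ?_⟩
        rw [← hγ]; simp [mul_assoc]
      · rintro ⟨δ, rfl⟩
        refine ⟨δ * γ⁻¹, ?_⟩
        rw [← hγ]; simp [mul_assoc]
    · intro q
      induction q using Quotient.inductionOn with
      | h x =>
        refine ⟨⟨_, x, rfl⟩, ?_⟩
        apply Quotient.sound
        generalize_proofs hp
        have hs := hp.choose_spec
        have hx : hp.choose ∈ {y : P | ∃ γ : P, φ γ * hp.choose * γ⁻¹ = y} := ⟨1, by simp⟩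
        have hs' : {y : P | ∃ γ : P, φ γ * hp.choose * γ⁻¹ = y} =
          {y : P | ∃ γ : P, φ γ * x * γ⁻¹ = y} := hs
        rw [hs'] at hx
        obtain ⟨γ, hγ⟩ := hx
        exact ⟨γ, hγ⟩
  have hfix : ∀ γ : P, Fintype.card (@MulAction.fixedBy P P _ act γ) =
      Fintype.card {x : P // x * γ * x⁻¹ = φ γ} := by
    intro γ
    refine Fintype.card_congr (Equiv.subtypeEquivRight fun x => ?_)
    change φ γ * x * γ⁻¹ = x ↔ _
    rw [mul_inv_eq_iff_eq_mul, mul_inv_eq_iff_eq_mul]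
    exact eq_comm
  have hcl : ∀ γ : P, Fintype.card {x : P // x * γ * x⁻¹ = φ γ} *
      Fintype.card {g // ConjClasses.mk g = ConjClasses.mk γ} =
      if ConjClasses.map (φ : P →* P) (ConjClasses.mk γ) = ConjClasses.mk γ then
        Fintype.card P else 0 := by
    intro γ
    split_ifs with h
    · have h' : IsConj γ (φ γ) := (ConjClasses.mk_eq_mk_iff_isConj.mp h).symm
      obtain ⟨x₀, hx₀⟩ := isConj_iff.mp h'
      rw [← Fintype.card_prod]
      refine Fintype.card_congr (Equiv.symm ?_)
      have hc : ∀ g : {g // ConjClasses.mk g = ConjClasses.mk γ}, ∃ y, y * g.1 * y⁻¹ = φ γ := by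
        intro g
        have := (ConjClasses.mk_eq_mk_iff_isConj.mp g.2).trans h'
        exact isConj_iff.mp this
      choose y hy using hc
      let cl : P → {g // ConjClasses.mk g = ConjClasses.mk γ} := fun x =>
        ⟨x * γ * x⁻¹, by
          rw [ConjClasses.mk_eq_mk_iff_isConj]
          exact (isConj_iff.mpr ⟨x, rfl⟩).symm⟩
      refine
        { toFun := fun x => ⟨⟨y (cl x) * x, ?_⟩, cl x⟩
          invFun := fun p => (y p.2)⁻¹ * p.1.1
          left_inv := fun x => by simp
          right_inv := fun p => ?_ }
      · rw [← hy (cl x)]; simp [cl, mul_assoc]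
      · have : cl ((y p.2)⁻¹ * p.1.1) = p.2 := by
          apply Subtype.ext
          have h1 := p.1.2
          have h2 := hy p.2
          have h3 : (cl ((y p.2)⁻¹ * p.1.1)).1 = (y p.2)⁻¹ * (p.1.1 * γ * p.1.1⁻¹) * y p.2 := by
            simp [cl, mul_assoc]
          have h4 : (y p.2)⁻¹ * (y p.2 * p.2.1 * (y p.2)⁻¹) * y p.2 = p.2.1 := by group
          rw [h3, h1]
          exact (congrArg (fun t => (y p.2)⁻¹ * t * y p.2) h2).symm.trans h4
        ext <;> simp [this]
    · rw [mul_eq_zero]; left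
      rw [Fintype.card_eq_zero_iff]
      refine ⟨fun x => h ?_⟩
      change ConjClasses.mk (φ γ) = _
      rw [ConjClasses.mk_eq_mk_iff_isConj]
      exact (isConj_iff.mpr ⟨x.1, x.2⟩).symm
  have hpos : (Fintype.card P : ℚ) ≠ 0 := by simp
  rw [h1]
  have hB' : (∑ γ : P, (Fintype.card {x : P // x * γ * x⁻¹ = φ γ} : ℚ)) =
      (Nat.card (Quotient (@MulAction.orbitRel P P _ act)) : ℚ) * Fintype.card P := by
    rw [@Nat.card_eq_fintype_card _ (Fintype.ofFinite _)]
    simp only [hfix] at hB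
    exact_mod_cast hB
  have hC : (∑ γ : P, (Fintype.card {x : P // x * γ * x⁻¹ = φ γ} : ℚ)) =
      (Nat.card {c : ConjClasses P // ConjClasses.map (φ : P →* P) c = c} : ℚ) *
        Fintype.card P := by
    rw [← Finset.sum_fiberwise (s := Finset.univ) (g := fun γ : P => ConjClasses.mk γ)]
    have : ∀ c : ConjClasses P,
        ∑ γ ∈ Finset.univ.filter (fun γ => ConjClasses.mk γ = c),
          (Fintype.card {x : P // x * γ * x⁻¹ = φ γ} : ℚ) =
        if ConjClasses.map (φ : P →* P) c = c then (Fintype.card P : ℚ) else 0 := by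
      intro c
      have hcn : (Fintype.card {g // ConjClasses.mk g = c} : ℚ) ≠ 0 := by
        obtain ⟨g, hg⟩ := ConjClasses.exists_rep c
        have : Nonempty {g // ConjClasses.mk g = c} := ⟨g, hg⟩
        exact Nat.cast_ne_zero.mpr Fintype.card_ne_zero
      have : ∀ γ ∈ Finset.univ.filter (fun γ => ConjClasses.mk γ = c),
          (Fintype.card {x : P // x * γ * x⁻¹ = φ γ} : ℚ) =
          (if ConjClasses.map (φ : P →* P) c = c then (Fintype.card P : ℚ) else 0) /
            (Fintype.card {g // ConjClasses.mk g = c} : ℚ) := by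
        intro γ hγ
        have hγ : ConjClasses.mk γ = c := by simpa using hγ
        subst hγ
        rw [eq_div_iff hcn]
        exact_mod_cast hcl γ
      rw [Finset.sum_congr rfl this, Finset.sum_const, ← Fintype.card_subtype, nsmul_eq_mul,
        mul_div_cancel₀ _ hcn]
    rw [Finset.sum_congr rfl fun c _ => this c, ← Finset.sum_filter, Finset.sum_const,
      ← Fintype.card_subtype, nsmul_eq_mul, Nat.card_eq_fintype_card]
  have := mul_right_cancel₀ hpos (hB'.symm.trans hC)
  exact_mod_cast this

/-- Irreducible characters, viewed as functions on conjugacy classes. -/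
def irrSet (P : Type) [Group P] : Set (ConjClasses P → ℂ) :=
  {f | ∃ R : IrrRep P, ∀ g, f (ConjClasses.mk g) = R.char g}

theorem irr_char_conj {P : Type} [Group P] (R : IrrRep P) {g h : P} (hc : IsConj g h) :
    R.char g = R.char h := by
  obtain ⟨c, rfl⟩ := isConj_iff.mp hc
  exact (Representation.char_conj (k := ℂ) (V := R.carrier) R.ρ g c).symm

/-- Pull back an irreducible representation along an automorphism. -/
def irrTwist {P : Type} [Group P] (φ : P ≃* P) (R : IrrRep P) : IrrRep P where
  carrier := R.carrier
  ρ := R.ρ.comp (φ : P →* P)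
  nontrivial := R.nontrivial
  irreducible := fun W hW => R.irreducible W fun g v hv => by
    have := hW (φ.symm g) v hv
    simpa using this

theorem irr_li (P : Type) [Group P] [Fintype P] :
    LinearIndependent ℂ (Subtype.val : irrSet P → (ConjClasses P → ℂ)) := by
  classical
  rw [linearIndependent_iff']
  intro s a hsum i hi
  obtain ⟨R, hR⟩ := i.2
  have h1 : ∑ g : P, (∑ j ∈ s, a j • j.1) (ConjClasses.mk g) * R.char g⁻¹ = 0 := by
    rw [hsum]; simp
  simp only [Finset.sum_apply, Pi.smul_apply, smul_eq_mul, Finset.sum_mul] at h1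
  rw [Finset.sum_comm, Finset.sum_eq_single i] at h1
  · simp only [hR, mul_assoc, ← Finset.mul_sum] at h1
    exact (mul_eq_zero.mp h1).resolve_right (aux_orth R R).2
  · intro j _ hji
    obtain ⟨S, hS⟩ := j.2
    simp only [hS, mul_assoc, ← Finset.mul_sum]
    rw [(aux_orth S R).1, mul_zero]
    intro h
    apply hji
    apply Subtype.ext
    funext c
    obtain ⟨g, rfl⟩ := ConjClasses.exists_rep c
    rw [hR, hS, h]
  · intro h; exact absurd hi h

theorem irr_span (P : Type) [Group P] [Fintype P] :
    ⊤ ≤ Submodule.span ℂ (Set.range (Subtype.val : irrSet P → (ConjClasses P → ℂ))) := by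
  classical
  rw [Subtype.range_coe]
  by_contra hn
  obtain ⟨l, hl, hle⟩ := Submodule.exists_le_ker_of_lt_top _ (lt_top_iff_ne_top.mpr
    fun h => hn h.ge)
  let n : ConjClasses P → ℂ := fun c => (Fintype.card {g : P // ConjClasses.mk g = c} : ℂ)
  have hnz : ∀ c, n c ≠ 0 := by
    intro c
    obtain ⟨g, hg⟩ := ConjClasses.exists_rep c
    have : Nonempty {g // ConjClasses.mk g = c} := ⟨g, hg⟩
    exact Nat.cast_ne_zero.mpr Fintype.card_ne_zero
  let a : ConjClasses P → ℂ := fun c => l (Pi.single c 1)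
  have hla : ∀ f, l f = ∑ c, a c * f c := by
    intro f
    conv_lhs => rw [pi_eq_sum_univ' f]
    simp only [map_sum, map_smul, smul_eq_mul]
    refine Finset.sum_congr rfl fun c _ => ?_
    rw [mul_comm]
  have hw := aux_complete (fun g : P => a (ConjClasses.mk g) / n (ConjClasses.mk g)) (by
      intro g h
      have : ConjClasses.mk (h * g * h⁻¹) = ConjClasses.mk g := by
        rw [ConjClasses.mk_eq_mk_iff_isConj]
        exact (isConj_iff.mpr ⟨h, rfl⟩).symm
      simp only [this]) (by
    intro R
    let f : ConjClasses P → ℂ := Quotient.lift R.char fun g h hc => irr_char_conj R hc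
    have hf : ∀ g, f (ConjClasses.mk g) = R.char g := fun g => rfl
    have h0 : l f = 0 := hle (Submodule.subset_span ⟨R, hf⟩)
    rw [hla] at h0
    rw [← h0, ← Finset.sum_fiberwise (s := Finset.univ) (g := fun γ : P => ConjClasses.mk γ)]
    refine Finset.sum_congr rfl fun c _ => ?_
    have : ∀ g ∈ Finset.univ.filter (fun γ => ConjClasses.mk γ = c),
        a (ConjClasses.mk g) / n (ConjClasses.mk g) * R.char g = a c * f c / n c := by
      intro g hg
      have hg : ConjClasses.mk g = c := by simpa using hg
      rw [← hf, hg]; ring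
    rw [Finset.sum_congr rfl this, Finset.sum_const, ← Fintype.card_subtype, nsmul_eq_mul]
    exact mul_div_cancel₀ _ (hnz c))
  apply hl
  refine LinearMap.ext fun f => ?_
  rw [hla, LinearMap.zero_apply]
  refine Finset.sum_eq_zero fun c _ => ?_
  obtain ⟨g, rfl⟩ := ConjClasses.exists_rep c
  have := congrFun hw g
  simp only [Pi.zero_apply, div_eq_zero_iff, hnz, or_false] at this
  rw [this, zero_mul]

theorem aux_fixed {P : Type} [Group P] [Finite P] (φ : P ≃* P) :
    Nat.card {c : ConjClasses P // ConjClasses.map (φ : P →* P) c = c} =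
    Nat.card ↥{χ : P → ℂ | (∃ ρ : IrrRep P, χ = IrrRep.char ρ) ∧ χ ∘ φ = χ} := by
  classical
  have := Fintype.ofFinite P
  let m := ConjClasses.map (φ : P →* P)
  let m' := ConjClasses.map (φ.symm : P →* P)
  have hmm' : ∀ c, m (m' c) = c := by
    intro c
    obtain ⟨g, rfl⟩ := ConjClasses.exists_rep c
    change ConjClasses.mk (φ (φ.symm g)) = _
    simp
  have hm'm : ∀ c, m' (m c) = c := by
    intro c
    obtain ⟨g, rfl⟩ := ConjClasses.exists_rep c
    change ConjClasses.mk (φ.symm (φ g)) = _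
    simp
  let T : (ConjClasses P → ℂ) →ₗ[ℂ] (ConjClasses P → ℂ) := LinearMap.funLeft ℂ ℂ m
  have t1 := aux_trace_perm (Pi.basisFun ℂ (ConjClasses P)) T m' (by
    intro c
    funext d
    change Pi.basisFun ℂ (ConjClasses P) c (m d) = _
    simp only [Pi.basisFun_apply, Pi.single_apply]
    congr 1
    apply propext
    constructor
    · rintro rfl; rw [hm'm]
    · rintro rfl; rw [hmm'])
  let B := Module.Basis.mk (irr_li P) (irr_span P)
  have : Finite (irrSet P) := Module.Finite.finite_basis B
  let s : irrSet P → irrSet P := fun f => ⟨fun c => f.1 (m c), by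
    obtain ⟨R, hR⟩ := f.2
    exact ⟨irrTwist φ R, fun g => hR (φ g)⟩⟩
  have t2 := aux_trace_perm B T s (by
    intro i
    simp only [B, Module.Basis.mk_apply]
    rfl)
  have t3 : Nat.card {c // m' c = c} = Nat.card {i // s i = i} := by
    exact_mod_cast t1.symm.trans t2
  have t4 : Nat.card {c : ConjClasses P // m c = c} = Nat.card {c // m' c = c} := by
    refine Nat.card_congr (Equiv.subtypeEquivRight fun c => ?_)
    constructor
    · intro h; conv_lhs => rw [← h, hm'm]
    · intro h; conv_lhs => rw [← h, hmm']
  refine t4.trans (t3.trans (Nat.card_congr ?_))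
  refine Equiv.ofBijective (fun i => ⟨fun g => i.1.1 (ConjClasses.mk g), ?_, ?_⟩) ⟨?_, ?_⟩
  · obtain ⟨R, hR⟩ := i.1.2
    exact ⟨R, funext hR⟩
  · funext g
    have := congrFun (congrArg Subtype.val i.2) (ConjClasses.mk g)
    exact this
  · intro i j h
    have h' := congrArg Subtype.val h
    apply Subtype.ext
    apply Subtype.ext
    funext c
    obtain ⟨g, rfl⟩ := ConjClasses.exists_rep c
    exact congrFun h' g
  · rintro ⟨χ, ⟨R, rfl⟩, hχ⟩
    let f : ConjClasses P → ℂ := Quotient.lift R.char fun g h hc => irr_char_conj R hc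
    refine ⟨⟨⟨f, R, fun g => rfl⟩, ?_⟩, rfl⟩
    apply Subtype.ext
    funext c
    obtain ⟨g, rfl⟩ := ConjClasses.exists_rep c
    exact congrFun hχ g


/-- For a finite group `P` with automorphism `φ`, the number of orbits of the
`φ`-conjugation action `γ • x = φ(γ)·x·γ⁻¹` equals the number of irreducible complex
characters `χ` of `P` with `χ ∘ φ = χ`. -/
theorem card_twisted_conjugacy_classes_eq_card_invariant_characters
    (P : Type) [Group P] [Finite P] (φ : P ≃* P) :
    Nat.card ↥(Set.range (fun x : P => {y : P | ∃ γ : P, φ γ * x * γ⁻¹ = y})) =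
    Nat.card ↥{χ : P → ℂ | (∃ ρ : IrrRep P, χ = IrrRep.char ρ) ∧ χ ∘ φ = χ} := by
  exact (aux_card φ).trans (aux_fixed φ)
end

section
/- Let F be a finite field, and let A be a finite-dimensional associative (not necessarily unital) F-algebra in which every element is nilpotent. Then for every irreducible finite-dimensional complex representation V of the algebra group A^×, there exist an F-subalgebra B ⊆ A and a group homomorphism χ : B^× → ℂˣ such that V is isomorphic, as a representation of A^×, to the representation induced from the one-dimensional representation χ of the subgroup B^×, i.e. V ≅ ℂ[A^×] ⊗_{ℂ[B^×]} ℂ_χ. -/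
/-- Powers in a non-unital ring: `nupow a k = a^(k+1)`. -/
def nupow {A : Type*} [NonUnitalRing A] (a : A) : ℕ → A
  | 0 => a
  | k + 1 => a * nupow a k

/-- A representation is irreducible if the space is nonzero and the only invariant
subspaces are `⊥` and `⊤`. -/
def IsIrreducibleRep {G V : Type*} [Group G] [AddCommGroup V] [Module ℂ V]
    (ρ : G →* (V →ₗ[ℂ] V)) : Prop :=
  (∃ v : V, v ≠ 0) ∧
    ∀ W : Submodule ℂ V, (∀ g : G, ∀ v ∈ W, ρ g v ∈ W) → W = ⊥ ∨ W = ⊤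

section GH
variable {A : Type*} [NonUnitalRing A] {G : Type*} [Group G] (e : G ≃ A)

theorem gh_inv (he1 : e 1 = 0) (hemul : ∀ g h : G, e (g * h) = e g + e h + e g * e h) (g : G) :
    e g + e g⁻¹ + e g * e g⁻¹ = 0 ∧ e g + e g⁻¹ + e g⁻¹ * e g = 0 := by
  constructor
  · rw [← hemul, mul_inv_cancel, he1]
  · rw [add_comm (e g), ← hemul, inv_mul_cancel, he1]

/-- difference of two elements in an ideal gives a quotient in the ideal -/
theorem gh_quot (he1 : e 1 = 0) (hemul : ∀ g h : G, e (g * h) = e g + e h + e g * e h)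
    (I : AddSubgroup A) (hI : ∀ a, ∀ x ∈ I, a * x ∈ I) (u v : G) (h : e v - e u ∈ I) :
    e (u⁻¹ * v) ∈ I := by
  have h1 := (gh_inv e he1 hemul u).2
  have : e (u⁻¹ * v) = (e v - e u) + e u⁻¹ * (e v - e u) := by
    rw [hemul]
    have : e u⁻¹ = - (e u + e u⁻¹ * e u) := by
      rw [eq_neg_iff_add_eq_zero, ← h1]; abel
    rw [mul_sub]
    nth_rewrite 1 [this]
    abel
  rw [this]
  exact I.add_mem h (hI _ _ h)

variable {Γ : Type*} [Group Γ] (R : G →* Γ)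

theorem gh_comm_iff (he1 : e 1 = 0) (hemul : ∀ g h : G, e (g * h) = e g + e h + e g * e h)
    (I : AddSubgroup A) (hI : ∀ a, ∀ x ∈ I, a * x ∈ I ∧ x * a ∈ I)
    (hR : ∀ z, e z ∈ I → ∀ g, Commute (R z) (R g))
    (a : A) (ha : ∀ b, a * b ∈ I ∧ b * a ∈ I) (b : A) :
    Commute (R (e.symm a)) (R (e.symm b)) ↔ R (e.symm (a * b)) = R (e.symm (b * a)) := by
  set g1 : G := (e.symm (-a))⁻¹ with hg1
  set h : G := e.symm b
  have hh : e h = b := by simp [h]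
  have i1 := gh_inv e he1 hemul (e.symm (-a))
  rw [← hg1] at i1
  simp only [Equiv.apply_symm_apply, neg_mul, mul_neg] at i1
  have k1 : e g1 = a + a * e g1 := by
    have := i1.1
    rw [← sub_eq_zero, ← this]; abel
  have k2 : e g1 = a + e g1 * a := by
    have := i1.2
    rw [← sub_eq_zero, ← this]; abel
  have key : h * g1 * e.symm (a * b) = e.symm (b * a) * g1 * h := by
    apply e.injective
    simp only [hemul, Equiv.apply_symm_apply, hh]
    have l1 : e g1 * (a * b) = e g1 * b - a * b := by
      rw [← mul_assoc]; nth_rewrite 2 [k2]; rw [add_mul]; abel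
    have l2 : (b * a) * e g1 = b * e g1 - b * a := by
      rw [mul_assoc]; nth_rewrite 2 [k1]; rw [mul_add]; abel
    have l3 : b * e g1 * (a * b) = b * e g1 * b - b * (a * b) := by
      rw [mul_assoc, l1, mul_sub, mul_assoc]
    simp only [add_mul, l1, l2, l3, sub_mul, mul_assoc]
    abel
  have c1 := hR (e.symm (a * b)) (by simpa using (ha b).1)
  have c2 := hR (e.symm (b * a)) (by simpa using (ha b).2)
  have key' := congrArg R key
  simp only [map_mul] at key'
  have s1 : Commute (R g1) (R h) ↔ R (e.symm (a * b)) = R (e.symm (b * a)) := by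
    have c4 : R (e.symm (b * a)) * R g1 * R h = R g1 * R h * R (e.symm (b * a)) := by
      rw [mul_assoc, ((c2 g1).mul_right (c2 h)).eq]
    rw [c4] at key'
    constructor
    · intro hc
      rw [← hc.eq] at key'
      exact mul_left_cancel key'
    · intro hc
      rw [hc] at key'
      exact (mul_right_cancel key').symm
  rw [← s1]
  have s2 : Commute (R g1) (R h) ↔ Commute (R (e.symm (-a))) (R h) := by
    rw [hg1, map_inv, Commute.inv_left_iff]
  rw [s2]
  have s3 : e.symm a * e.symm (-a) = e.symm (- (a * a)) := by
    apply e.injective; simp [hemul]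
  have c3 := hR (e.symm (-(a * a))) (by simpa using (ha a).1) h
  rw [← s3, map_mul] at c3
  constructor
  · intro hc
    have := (hc.inv_left).mul_left c3
    simpa using this
  · intro hc
    have := c3.mul_left (hc.inv_left)
    simpa using this

variable {F : Type*} [Field F] [Module F A] [IsScalarTower F A A] [SMulCommClass F A A]

/-- The subalgebra of elements commuting (after applying `R`) with the line through `a`. -/
theorem gh_subalg (he1 : e 1 = 0) (hemul : ∀ g h : G, e (g * h) = e g + e h + e g * e h)
    (I : Submodule F A) (hI : ∀ a, ∀ x ∈ I, a * x ∈ I ∧ x * a ∈ I)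
    (hR : ∀ z, e z ∈ I → ∀ g, Commute (R z) (R g))
    (a : A) (ha : ∀ b, a * b ∈ I ∧ b * a ∈ I) :
    ∃ B : NonUnitalSubalgebra F A, ∀ g : G,
      e g ∈ B ↔ ∀ c : F, Commute (R (e.symm (c • a))) (R g) := by
  have key := gh_comm_iff e R he1 hemul I.toAddSubgroup hI hR
  have hsm : ∀ c : F, ∀ b, (c • a) * b ∈ I ∧ b * (c • a) ∈ I := by
    intro c b
    rw [smul_mul_assoc, mul_smul_comm]
    exact ⟨I.smul_mem _ (ha b).1, I.smul_mem _ (ha b).2⟩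
  have hmul : ∀ u v : A, Commute (R (e.symm a)) (R (e.symm (u * v))) := by
    intro u v
    rw [key a ha, ← mul_assoc]
    have h1 := (key (a * u) (fun b => ⟨(hI _ _ (ha u).1).2, (hI _ _ (ha u).1).1⟩) v).1
      (hR _ (by simpa using (ha u).1) _)
    have h2 := (key (v * a) (fun b => ⟨(hI _ _ (ha v).2).2, (hI _ _ (ha v).2).1⟩) u).1
      (hR _ (by simpa using (ha v).2) _)
    rw [h1, ← mul_assoc, h2, mul_assoc]
  have hadd1 : ∀ y u v : A, Commute (R (e.symm a)) (R (e.symm y)) →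
      Commute (R (e.symm a)) (R (e.symm (y + u * v))) := by
    intro y u v hy
    set g := e.symm y with hg
    have hgy : e g = y := by simp [hg]
    have h1 := (gh_inv e he1 hemul g).1
    have : e.symm (y + u * v) = g * e.symm ((u + e g⁻¹ * u) * v) := by
      apply e.injective
      rw [hemul]
      simp only [Equiv.apply_symm_apply]
      have h2 : e g * (u + e g⁻¹ * u) = - (e g⁻¹ * u) := by
        have h3 : e g * e g⁻¹ = - e g - e g⁻¹ := by
          rw [← sub_eq_zero, ← h1]; abel
        rw [mul_add, ← mul_assoc, h3]
        simp only [sub_mul, neg_mul]; abel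
      rw [← mul_assoc, h2, hgy]
      simp only [add_mul, neg_mul]; abel
    rw [this, map_mul]
    exact hy.mul_right (hmul _ _)
  have hadd : ∀ y z : A, Commute (R (e.symm a)) (R (e.symm y)) →
      Commute (R (e.symm a)) (R (e.symm z)) → Commute (R (e.symm a)) (R (e.symm (y + z))) := by
    intro y z hy hz
    have h1 : e.symm (y + z + y * z) = e.symm y * e.symm z := by
      apply e.injective; simp [hemul]
    have h2 := hadd1 (y + z + y * z) (-y) z (by rw [h1, map_mul]; exact hy.mul_right hz)
    simpa using h2
  have hs : ∀ (c : F) (b : A), Commute (R (e.symm (c • a))) (R (e.symm b)) ↔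
      Commute (R (e.symm a)) (R (e.symm (c • b))) := by
    intro c b
    rw [key _ (hsm c), key _ ha, smul_mul_assoc, mul_smul_comm, mul_smul_comm, smul_mul_assoc]
  refine ⟨
    { carrier := {b | ∀ c : F, Commute (R (e.symm a)) (R (e.symm (c • b)))}
      add_mem' := ?_, zero_mem' := ?_, mul_mem' := ?_, smul_mem' := ?_ }, ?_⟩
  · intro x y hx hy c
    rw [smul_add]; exact hadd _ _ (hx c) (hy c)
  · intro c
    have : e.symm 0 = 1 := by rw [← he1]; simp
    simp [this]
  · intro x y hx hy c
    rw [← smul_mul_assoc]; exact hmul _ _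
  · intro c x hx d
    rw [smul_smul]; exact hx _
  · intro g
    change (∀ c : F, Commute (R (e.symm a)) (R (e.symm (c • e g)))) ↔ _
    refine forall_congr' fun c => ?_
    rw [← hs, Equiv.symm_apply_apply]

end GH

theorem gh_fixed {F : Type*} [Field F] [Fintype F]
    {A : Type*} [NonUnitalRing A] [Module F A]
    [IsScalarTower F A A] [SMulCommClass F A A] [FiniteDimensional F A]
    {G : Type*} [Group G] (e : G ≃ A)
    (he1 : e 1 = 0) (hemul : ∀ g h : G, e (g * h) = e g + e h + e g * e h)
    (I : Submodule F A) (hI : ∀ a, ∀ x ∈ I, a * x ∈ I ∧ x * a ∈ I) (hne : I ≠ ⊤) :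
    ∃ x, x ∉ I ∧ ∀ b, x * b ∈ I ∧ b * x ∈ I := by
  let T : G × G → (A →ₗ[F] A) := fun p =>
    (LinearMap.id + LinearMap.mulLeft F (e p.1)) ∘ₗ (LinearMap.id + LinearMap.mulRight F (e p.2⁻¹))
  have hT : ∀ p x, T p x = x + x * e p.2⁻¹ + e p.1 * (x + x * e p.2⁻¹) := by
    intro p x; simp [T]
  have hTI : ∀ p, I ≤ I.comap (T p) := by
    intro p x hx
    rw [Submodule.mem_comap, hT]
    have h1 : x + x * e p.2⁻¹ ∈ I := I.add_mem hx (hI _ _ hx).2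
    exact I.add_mem h1 (hI _ _ h1).1
  let _ : MulAction (G × G) (A ⧸ I) :=
    { smul := fun p x => I.mapQ I (T p) (hTI p) x
      one_smul := by
        intro x
        induction x using Submodule.Quotient.induction_on with | _ x => ?_
        change I.mapQ I (T 1) (hTI 1) _ = _
        rw [Submodule.mapQ_apply, hT]; simp [he1]
      mul_smul := by
        intro p q x
        induction x using Submodule.Quotient.induction_on with | _ x => ?_
        change I.mapQ I (T (p * q)) (hTI _) _ = I.mapQ I (T p) (hTI _) (I.mapQ I (T q) (hTI _) _)
        simp only [Submodule.mapQ_apply, hT]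
        congr 1
        simp only [Prod.fst_mul, Prod.snd_mul, mul_inv_rev, hemul, mul_add, add_mul, mul_assoc]
        abel }
  have hsm : ∀ (p : G × G) (x : A), p • (Submodule.Quotient.mk x : A ⧸ I) =
      Submodule.Quotient.mk (T p x) := fun p x => rfl
  obtain ⟨p, _, n, hp, hn⟩ := FiniteField.card' F
  have : Fact p.Prime := ⟨hp⟩
  have : Finite A := Module.finite_of_finite F
  have hFn : Nat.card F = p ^ (n : ℕ) := by rw [Nat.card_eq_fintype_card, hn]
  have hA : Nat.card A = (p ^ (n : ℕ)) ^ Module.finrank F A := by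
    rw [← hFn]; exact Module.natCard_eq_pow_finrank
  have hQ : Nat.card (A ⧸ I) = (p ^ (n : ℕ)) ^ Module.finrank F (A ⧸ I) := by
    rw [← hFn]; exact Module.natCard_eq_pow_finrank
  have hG : IsPGroup p (G × G) := by
    apply IsPGroup.of_card (n := (n : ℕ) * Module.finrank F A + (n : ℕ) * Module.finrank F A)
    rw [Nat.card_prod, Nat.card_congr e, hA, pow_add, pow_mul]
  have hnt : Nontrivial (A ⧸ I) := Submodule.Quotient.nontrivial_iff.2 hne
  have hdvd : p ∣ Nat.card (A ⧸ I) := by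
    rw [hQ, ← pow_mul]
    apply dvd_pow_self
    have := Module.finrank_pos (R := F) (M := A ⧸ I)
    have := n.pos
    positivity
  have : Finite (A ⧸ I) := Quotient.finite _
  obtain ⟨b, hb, hb0⟩ := hG.exists_fixed_point_of_prime_dvd_card_of_fixed_point (A ⧸ I) hdvd
    (a := 0) (by
      intro p
      change p • (Submodule.Quotient.mk 0 : A ⧸ I) = _
      rw [hsm, map_zero]; rfl)
  induction b using Submodule.Quotient.induction_on with | _ x => ?_
  refine ⟨x, fun hx => hb0 ((Submodule.Quotient.mk_eq_zero I).2 hx).symm, fun c => ⟨?_, ?_⟩⟩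
  · have := hb (1, (e.symm c)⁻¹)
    rw [hsm, hT, Submodule.Quotient.eq] at this
    simpa [he1] using this
  · have := hb (e.symm c, 1)
    rw [hsm, hT, Submodule.Quotient.eq] at this
    simpa [he1] using this

section Cliff
variable {G V : Type*} [Group G] [Finite G] [AddCommGroup V] [Module ℂ V] [FiniteDimensional ℂ V]

theorem gh_cliff (ρ : G →* (V →ₗ[ℂ] V)) (hirr : IsIrreducibleRep ρ) (H : Subgroup G)
    (W : Submodule ℂ V) (hW : ∀ h ∈ H, ∀ v ∈ W, ρ h v ∈ W) (hne : W ≠ ⊥)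
    (hind : iSupIndep fun q : G ⧸ H => W.map (ρ q.out)) :
    Module.finrank ℂ V = H.index * Module.finrank ℂ W := by
  have hinv : ∀ g v, ρ g⁻¹ (ρ g v) = v := by
    intro g v
    rw [← Module.End.mul_apply, ← map_mul, inv_mul_cancel, map_one]; rfl
  have hmem : ∀ (g : G) (w : V), w ∈ W → ρ g w ∈ W.map (ρ (g : G ⧸ H).out) := by
    intro g w hw
    obtain ⟨h, hh⟩ := QuotientGroup.mk_out_eq_mul H g
    refine ⟨ρ (h⁻¹ : G) w, hW _ (H.inv_mem h.2) _ hw, ?_⟩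
    rw [hh, ← Module.End.mul_apply, ← map_mul]; simp
  have htop : (⨆ q : G ⧸ H, W.map (ρ q.out)) = ⊤ := by
    refine (hirr.2 _ ?_).resolve_left ?_
    · intro g v hv
      suffices h : (⨆ q : G ⧸ H, W.map (ρ q.out)) ≤
          (⨆ q : G ⧸ H, W.map (ρ q.out)).comap (ρ g) from h hv
      refine iSup_le fun q => ?_
      rintro _ ⟨w, hw, rfl⟩
      rw [Submodule.mem_comap, ← Module.End.mul_apply, ← map_mul]
      exact (le_iSup (fun q : G ⧸ H => W.map (ρ q.out)) _) (hmem _ w hw)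
    · intro hbot
      apply hne
      rw [eq_bot_iff]
      intro w hw
      have h1 := (le_iSup (fun q : G ⧸ H => W.map (ρ q.out)) _) (hmem 1 w hw)
      rw [hbot] at h1
      simpa using h1
  classical
  have : Fintype (G ⧸ H) := Fintype.ofFinite _
  have hint := DirectSum.isInternal_submodule_of_iSupIndep_of_iSup_eq_top hind htop
  let b := hint.collectedBasis (fun q => Module.finBasis ℂ _)
  rw [Module.finrank_eq_card_basis b, Fintype.card_sigma]
  have : ∀ q : G ⧸ H, Module.finrank ℂ (W.map (ρ q.out)) = Module.finrank ℂ W := by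
    intro q
    refine (LinearEquiv.finrank_eq (Submodule.equivMapOfInjective (ρ q.out) ?_ W)).symm
    intro v w hvw
    rw [← hinv q.out v, hvw, hinv]
  simp only [Fintype.card_fin, this, Finset.sum_const, smul_eq_mul, Finset.card_univ]
  rw [Subgroup.index, Nat.card_eq_fintype_card]

/-- The restriction of a representation to a subgroup and a stable subspace. -/
noncomputable def ghRestr (ρ : G →* (V →ₗ[ℂ] V)) (H : Subgroup G)
    (W : Submodule ℂ V) (hW : ∀ h ∈ H, ∀ v ∈ W, ρ h v ∈ W) : H →* (W →ₗ[ℂ] W) where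
  toFun h := (ρ h).restrict (hW h h.2)
  map_one' := by ext; simp
  map_mul' := by intros; ext; simp

theorem gh_cliff_irr (ρ : G →* (V →ₗ[ℂ] V)) (hirr : IsIrreducibleRep ρ) (H : Subgroup G)
    (W : Submodule ℂ V) (hW : ∀ h ∈ H, ∀ v ∈ W, ρ h v ∈ W) (hne : W ≠ ⊥)
    (hind : iSupIndep fun q : G ⧸ H => W.map (ρ q.out)) :
    IsIrreducibleRep (ghRestr ρ H W hW) := by
  constructor
  · obtain ⟨w, hw, h0⟩ := W.exists_mem_ne_zero_of_ne_bot hne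
    exact ⟨⟨w, hw⟩, by simpa using h0⟩
  · intro W' hW'
    by_cases h0 : W' = ⊥
    · exact Or.inl h0
    right
    have h1 := gh_cliff ρ hirr H W hW hne hind
    have h2 := gh_cliff ρ hirr H (W'.map W.subtype) (by
        rintro h hh _ ⟨w, hw, rfl⟩
        exact ⟨_, hW' ⟨h, hh⟩ w hw, rfl⟩)
      (by
        intro hb
        apply h0
        exact Submodule.map_injective_of_injective W.injective_subtype (by rw [hb, Submodule.map_bot]))
      (hind.mono fun q => Submodule.map_mono (Submodule.map_subtype_le _ _))
    have h3 : Module.finrank ℂ (W'.map W.subtype) = Module.finrank ℂ W' :=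
      (LinearEquiv.finrank_eq (Submodule.equivMapOfInjective _ W.injective_subtype W')).symm
    have h4 : H.index ≠ 0 := Subgroup.FiniteIndex.index_ne_zero
    apply Submodule.eq_top_of_finrank_eq
    rw [h1, h3] at h2
    exact (Nat.eq_of_mul_eq_mul_left (Nat.pos_of_ne_zero h4) h2).symm

/-- Schur's lemma. -/
theorem gh_schur (ρ : G →* (V →ₗ[ℂ] V)) (hirr : IsIrreducibleRep ρ) (f : V →ₗ[ℂ] V)
    (hf : ∀ g, Commute f (ρ g)) : ∃ c : ℂ, f = c • 1 := by
  obtain ⟨v, hv⟩ := hirr.1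
  have : Nontrivial V := ⟨v, 0, hv⟩
  obtain ⟨c, hc⟩ := Module.End.exists_eigenvalue f
  refine ⟨c, ?_⟩
  have := (hirr.2 (Module.End.eigenspace f c) ?_).resolve_left hc
  · ext w
    have hw : w ∈ Module.End.eigenspace f c := by rw [this]; trivial
    simpa using Module.End.mem_eigenspace_iff.1 hw
  · intro g w hw
    rw [Module.End.mem_eigenspace_iff] at *
    rw [← Module.End.mul_apply, (hf g).eq, Module.End.mul_apply, hw, map_smul]

end Cliff

theorem gh_maxGen {V : Type*} [AddCommGroup V] [Module ℂ V] (f p : V →ₗ[ℂ] V) (z μ : ℂ)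
    (h : f * p = z • (p * f)) (v : V) (hv : v ∈ Module.End.maxGenEigenspace f μ) :
    p v ∈ Module.End.maxGenEigenspace f (z * μ) := by
  rw [Module.End.mem_maxGenEigenspace] at *
  obtain ⟨k, hk⟩ := hv
  refine ⟨k, ?_⟩
  have h1 : (f - (z * μ) • (1 : Module.End ℂ V)) * p = z • (p * (f - μ • (1 : Module.End ℂ V))) := by
    rw [sub_mul, h, mul_sub, smul_sub]
    simp [smul_smul]
  have h2 : ∀ k : ℕ, (f - (z * μ) • (1 : Module.End ℂ V)) ^ k * p =
      z ^ k • (p * (f - μ • (1 : Module.End ℂ V)) ^ k) := by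
    intro k
    induction k with
    | zero => simp
    | succ k ih =>
      rw [pow_succ', mul_assoc, ih, mul_smul_comm, ← mul_assoc, h1, smul_mul_assoc, smul_smul,
        pow_succ, pow_succ', mul_assoc, ← pow_succ']
  rw [← Module.End.mul_apply, h2]
  simp [hk]

theorem gh_step {F : Type*} [Field F] [Fintype F]
    {A : Type*} [NonUnitalRing A] [Module F A]
    [IsScalarTower F A A] [SMulCommClass F A A] [FiniteDimensional F A]
    {G : Type*} [Group G] [Finite G] (e : G ≃ A)
    (he1 : e 1 = 0) (hemul : ∀ g h : G, e (g * h) = e g + e h + e g * e h)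
    {V : Type*} [AddCommGroup V] [Module ℂ V] [FiniteDimensional ℂ V]
    (ρ : G →* (V →ₗ[ℂ] V)) (hirr : IsIrreducibleRep ρ)
    (hns : ¬ ∀ g, ∃ c : ℂ, ρ g = c • 1) :
    ∃ (B : NonUnitalSubalgebra F A) (H : Subgroup G) (W : Submodule ℂ V),
      (∀ g, g ∈ H ↔ e g ∈ B) ∧ B ≠ ⊤ ∧ (∀ h ∈ H, ∀ v ∈ W, ρ h v ∈ W) ∧ W ≠ ⊥ ∧
      iSupIndep fun q : G ⧸ H => W.map (ρ q.out) := by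
  obtain ⟨v0, hv0⟩ := hirr.1
  have : Nontrivial V := ⟨v0, 0, hv0⟩
  have : Finite A := Finite.of_equiv G e
  -- the maximal ideal acting by scalars
  let S : Set (Submodule F A) := {I | (∀ a, ∀ x ∈ I, a * x ∈ I ∧ x * a ∈ I) ∧
    ∀ g, e g ∈ I → ∃ c : ℂ, ρ g = c • 1}
  have hS : S.Nonempty := by
    refine ⟨⊥, ?_, ?_⟩
    · intro a x hx
      rw [Submodule.mem_bot] at hx
      simp [hx]
    · intro g hg
      rw [Submodule.mem_bot, ← he1] at hg
      exact ⟨1, by rw [e.injective hg]; simp⟩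
  obtain ⟨I, ⟨hI, hIs⟩, hmax⟩ := WellFounded.has_min
    (wellFounded_gt (α := Submodule F A)) S hS
  have hne : I ≠ ⊤ := by
    rintro rfl
    exact hns fun g => hIs g trivial
  obtain ⟨x, hxI, hx⟩ := gh_fixed e he1 hemul I hI hne
  let R := ρ.toHomUnits
  have hRc : ∀ g h, Commute (R g) (R h) ↔ Commute (ρ g) (ρ h) := by
    intro g h
    rw [← Commute.units_val_iff]
    rfl
  obtain ⟨B, hB⟩ := gh_subalg e R he1 hemul I hI (by
    intro z hz g
    rw [hRc]
    obtain ⟨c, hc⟩ := hIs z hz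
    rw [hc]
    exact (Commute.one_left _).smul_left c) x hx
  let H : Subgroup G := (Subgroup.centralizer
    (Set.range fun c : F => R (e.symm (c • x)))).comap R
  have hH : ∀ g, g ∈ H ↔ ∀ c : F, Commute (R (e.symm (c • x))) (R g) := by
    intro g
    simp only [H, Subgroup.mem_comap, Subgroup.mem_centralizer_iff, Set.forall_mem_range]
    rfl
  have hunit : ∀ g v, ρ g v = 0 → v = 0 := by
    intro g v h
    have h1 : ρ g⁻¹ (ρ g v) = v := by
      rw [← Module.End.mul_apply, ← map_mul, inv_mul_cancel, map_one]; rfl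
    rw [← h1, h, map_zero]
  have hsc : ∀ (g : G) (c : F), ∃ z : ℂ,
      ρ (e.symm (c • x)) * ρ g = z • (ρ g * ρ (e.symm (c • x))) := by
    intro g c
    obtain ⟨z, hz⟩ := hIs ((g * e.symm (c • x))⁻¹ * (e.symm (c • x) * g)) (by
      refine gh_quot e he1 hemul I.toAddSubgroup (fun a x hx => (hI a x hx).1) _ _ ?_
      simp only [hemul, Equiv.apply_symm_apply, smul_mul_assoc, mul_smul_comm]
      have : c • x + e g + c • (x * e g) - (e g + c • x + c • (e g * x)) =
        c • (x * e g) - c • (e g * x) := by abel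
      rw [this]
      exact I.sub_mem (I.smul_mem _ (hx _).1) (I.smul_mem _ (hx _).2))
    refine ⟨z, ?_⟩
    have : e.symm (c • x) * g =
      (g * e.symm (c • x)) * ((g * e.symm (c • x))⁻¹ * (e.symm (c • x) * g)) := by group
    rw [← map_mul, this, map_mul, hz, map_mul]
    simp
  choose z hz using hsc
  let f : F → Module.End ℂ V := fun c => ρ (e.symm (c • x))
  have hfc : ∀ i j, Commute (f i) (f j) := by
    intro i j
    have : e.symm (i • x) * e.symm (j • x) = e.symm (j • x) * e.symm (i • x) := by
      apply e.injective
      simp only [hemul, Equiv.apply_symm_apply, smul_mul_assoc, mul_smul_comm]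
      rw [smul_comm i j]; abel
    change ρ _ * ρ _ = ρ _ * ρ _
    rw [← map_mul, this, map_mul]
  have htop := Module.End.iSup_iInf_maxGenEigenspace_eq_top_of_iSup_maxGenEigenspace_eq_top_of_commute
    f (fun i j _ => hfc i j) (fun i => Module.End.iSup_maxGenEigenspace_eq_top _)
  have hind := Module.End.independent_iInf_maxGenEigenspace_of_forall_mapsTo f
    (fun i j => Module.End.mapsTo_maxGenEigenspace_of_comm (hfc j i))
  obtain ⟨χ, hχ⟩ : ∃ χ : F → ℂ, (⨅ i, (f i).maxGenEigenspace (χ i)) ≠ ⊥ := by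
    by_contra hcon
    push Not at hcon
    simp [hcon] at htop
  have hχ0 : ∀ c, χ c ≠ 0 := by
    intro c hc
    obtain ⟨w, hw, hw0⟩ := Submodule.exists_mem_ne_zero_of_ne_bot hχ
    rw [Submodule.mem_iInf] at hw
    have h1 := hw c
    rw [hc, Module.End.mem_maxGenEigenspace] at h1
    obtain ⟨k, hk⟩ := h1
    rw [zero_smul, sub_zero] at hk
    change (ρ (e.symm (c • x)) ^ k) w = 0 at hk
    rw [← map_pow] at hk
    exact hw0 (hunit _ _ hk)
  have hmap : ∀ g, ∀ w ∈ (⨅ i, (f i).maxGenEigenspace (χ i)),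
      ρ g w ∈ (⨅ i, (f i).maxGenEigenspace (z g i * χ i)) := by
    intro g w hw
    rw [Submodule.mem_iInf] at *
    exact fun i => gh_maxGen _ _ _ _ (hz g i) _ (hw i)
  have hinj : ∀ g g' : G, (∀ c, z g c = z g' c) → g⁻¹ * g' ∈ H := by
    intro g g' h
    rw [hH]
    intro c
    rw [hRc]
    have h1 := hz g c
    have h2 := hz g' c
    rw [← h c] at h2
    have hz0 : z g c ≠ 0 := by
      intro h0
      rw [h0, zero_smul, ← map_mul] at h1
      exact hv0 (hunit _ v0 (by rw [h1]; rfl))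
    have h3 : ρ g⁻¹ * ρ (e.symm (c • x)) = z g c • (ρ (e.symm (c • x)) * ρ g⁻¹) := by
      have h4 : ρ g⁻¹ * (ρ (e.symm (c • x)) * ρ g) * ρ g⁻¹ =
        ρ g⁻¹ * (z g c • (ρ g * ρ (e.symm (c • x)))) * ρ g⁻¹ := by rw [h1]
      have h5 : ρ g⁻¹ * ρ g = 1 := by rw [← map_mul]; simp
      have h6 : ρ g * ρ g⁻¹ = 1 := by rw [← map_mul]; simp
      rw [mul_smul_comm, ← mul_assoc (ρ g⁻¹) (ρ g), h5, one_mul, mul_assoc, mul_assoc, h6,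
        mul_one, smul_mul_assoc] at h4
      exact h4
    have h4 : z g c • (ρ (e.symm (c • x)) * ρ (g⁻¹ * g')) =
        z g c • (ρ (g⁻¹ * g') * ρ (e.symm (c • x))) := by
      rw [map_mul, ← mul_assoc, ← smul_mul_assoc, ← h3, mul_assoc, h2, mul_smul_comm, mul_assoc]
    exact smul_right_injective _ hz0 h4
  refine ⟨B, H, ⨅ i, (f i).maxGenEigenspace (χ i), fun g => ?_, ?_, ?_, hχ, ?_⟩
  · rw [hH, hB]
  · rintro rfl
    have hsc : ∀ c : F, ∃ t : ℂ, ρ (e.symm (c • x)) = t • 1 := by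
      intro c
      refine gh_schur ρ hirr _ fun g => ?_
      rw [← hRc]
      exact (hB g).1 trivial c
    refine hmax (I ⊔ Submodule.span F {x}) ⟨?_, ?_⟩ ?_
    · intro a y hy
      obtain ⟨i, hi, w, hw, rfl⟩ := Submodule.mem_sup.1 hy
      obtain ⟨c, rfl⟩ := Submodule.mem_span_singleton.1 hw
      rw [mul_add, add_mul, smul_mul_assoc, mul_smul_comm]
      exact ⟨(le_sup_left : I ≤ _) (I.add_mem (hI _ _ hi).1 (I.smul_mem _ (hx _).2)),
        (le_sup_left : I ≤ _) (I.add_mem (hI _ _ hi).2 (I.smul_mem _ (hx _).1))⟩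
    · intro g hg
      obtain ⟨i, hi, w, hw, hiw⟩ := Submodule.mem_sup.1 hg
      obtain ⟨c, rfl⟩ := Submodule.mem_span_singleton.1 hw
      obtain ⟨s, hs⟩ := hIs ((e.symm (c • x))⁻¹ * g) (by
        refine gh_quot e he1 hemul I.toAddSubgroup (fun a x hx => (hI a x hx).1) _ _ ?_
        rw [← hiw]; simpa using hi)
      obtain ⟨t, ht⟩ := hsc c
      refine ⟨t * s, ?_⟩
      have : g = e.symm (c • x) * ((e.symm (c • x))⁻¹ * g) := by group
      rw [this, map_mul, hs, ht]
      simp [smul_smul, mul_comm]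
    · refine lt_of_le_of_ne le_sup_left fun h => hxI ?_
      rw [h]
      exact (le_sup_right : Submodule.span F {x} ≤ _) (Submodule.mem_span_singleton_self x)
  · intro h hh w hw
    have h1 := hmap h w hw
    have h2 : ∀ c, z h c = 1 := by
      intro c
      have h3 := ((hRc _ _).1 ((hH h).1 hh c)).eq
      rw [hz h c, ← map_mul] at h3
      by_contra hne1
      have h4 : (z h c - 1) • ρ (h * e.symm (c • x)) = 0 := by
        rw [sub_smul, h3, one_smul, sub_self]
      rw [smul_eq_zero] at h4
      rcases h4 with h4 | h4
      · exact hne1 (sub_eq_zero.1 h4)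
      · exact hv0 (hunit _ v0 (by rw [h4]; rfl))
    simpa [h2] using h1
  · have hind2 := hind.comp (f := fun (q : G ⧸ H) (i : F) => z q.out i * χ i) (by
      intro q q' hq
      have h1 := hinj q.out q'.out fun c => mul_right_cancel₀ (hχ0 c) (congrFun hq c)
      rw [← QuotientGroup.eq] at h1
      simpa using h1)
    refine hind2.mono fun q => ?_
    rintro _ ⟨w, hw, rfl⟩
    exact hmap _ w hw

theorem gh_main.{uF, uA, uG, uV} (F : Type uF) [Field F] [Fintype F] (n : ℕ) :
    ∀ (A : Type uA) [NonUnitalRing A] [Module F A]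
    [IsScalarTower F A A] [SMulCommClass F A A] [FiniteDimensional F A]
    (_ : Module.finrank F A = n)
    (G : Type uG) [Group G] (e : G ≃ A)
    (_ : e 1 = 0)
    (_ : ∀ g h : G, e (g * h) = e g + e h + e g * e h)
    (V : Type uV) [AddCommGroup V] [Module ℂ V] [FiniteDimensional ℂ V]
    (ρ : G →* (V →ₗ[ℂ] V)) (_ : IsIrreducibleRep ρ),
    ∃ (B : NonUnitalSubalgebra F A) (χ : G → ℂˣ),
      (∀ g h : G, e g ∈ B → e h ∈ B → χ (g * h) = χ g * χ h) ∧
      (∃ v : V, v ≠ 0 ∧ ∀ h : G, e h ∈ B → ρ h v = ((χ h : ℂˣ) : ℂ) • v) ∧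
      Nat.card {g : G // e g ∈ B} * Module.finrank ℂ V = Nat.card G := by
  induction n using Nat.strong_induction_on with | _ n ih => ?_
  intro A _ _ _ _ _ hn G _ e he1 hemul V _ _ _ ρ hirr
  have : Finite A := Module.finite_of_finite F
  have : Finite G := Finite.of_equiv A e.symm
  by_cases hs : ∀ g, ∃ c : ℂ, ρ g = c • 1
  · obtain ⟨v, hv⟩ := hirr.1
    choose c hc using hs
    have hv' : ∀ g, ρ g v = c g • v := by intro g; rw [hc]; simp
    have hmul : ∀ g h, c (g * h) = c g * c h := by
      intro g h
      apply smul_left_injective ℂ hv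
      change c (g * h) • v = (c g * c h) • v
      rw [← hv', map_mul, Module.End.mul_apply, hv', map_smul, hv', smul_smul, mul_comm]
    have hone : c 1 = 1 := by
      apply smul_left_injective ℂ hv
      change c 1 • v = (1 : ℂ) • v
      rw [← hv']; simp
    let χ : G → ℂˣ := fun g => ⟨c g, c g⁻¹, by rw [← hmul, mul_inv_cancel, hone],
      by rw [← hmul, inv_mul_cancel, hone]⟩
    refine ⟨⊤, χ, fun g h _ _ => Units.ext (hmul g h), ⟨v, hv, fun h _ => hv' h⟩, ?_⟩
    have hsp := (hirr.2 (Submodule.span ℂ {v}) (by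
      intro g w hw
      rw [hc]
      exact Submodule.smul_mem _ _ hw)).resolve_left (by
        intro hb; exact hv (Submodule.span_singleton_eq_bot.1 hb))
    have h1 : Module.finrank ℂ V = 1 := by
      rw [← finrank_top, ← hsp, finrank_span_singleton hv]
    rw [h1, mul_one]
    exact Nat.card_congr (Equiv.subtypeUnivEquiv fun _ => trivial)
  · obtain ⟨B, H, W, hHB, hBt, hW, hW0, hind⟩ := gh_step (F := F) e he1 hemul ρ hirr hs
    have hrank := gh_cliff ρ hirr H W hW hW0 hind
    have hWirr := gh_cliff_irr ρ hirr H W hW hW0 hind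
    let e' : H ≃ B := e.subtypeEquiv hHB
    have he' : ∀ h : H, ((e' h : B) : A) = e h := fun h => rfl
    have hlt : Module.finrank F B < n := by
      rw [← hn]
      apply Submodule.finrank_lt (s := B.toSubmodule)
      intro h
      apply hBt
      rw [eq_top_iff]
      intro x _
      have : x ∈ B.toSubmodule := by rw [h]; trivial
      exact this
    obtain ⟨B', χ', hm, ⟨v, hv, hχv⟩, hcard⟩ := ih _ hlt B rfl H e'
      (Subtype.ext (by rw [he']; simpa using he1))
      (fun g h => Subtype.ext (by
        change e ((g : G) * h) = _
        rw [hemul]; rfl)) W (ghRestr ρ H W hW) hWirr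
    classical
    have hmem : ∀ g : G, e g ∈ B'.map (NonUnitalSubalgebraClass.subtype B) ↔
        ∃ h : g ∈ H, e' ⟨g, h⟩ ∈ B' := by
      intro g
      rw [NonUnitalSubalgebra.mem_map]
      constructor
      · rintro ⟨b, hb, hbe⟩
        have hg : g ∈ H := by
          rw [hHB, ← hbe]; exact b.2
        refine ⟨hg, ?_⟩
        have : e' ⟨g, hg⟩ = b := Subtype.ext hbe.symm
        rw [this]; exact hb
      · rintro ⟨h, hb⟩
        exact ⟨_, hb, rfl⟩
    refine ⟨B'.map (NonUnitalSubalgebraClass.subtype B),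
      fun g => if h : g ∈ H then χ' ⟨g, h⟩ else 1, ?_, ⟨v, by simpa using hv, ?_⟩, ?_⟩
    · intro g h hg hh
      obtain ⟨hg1, hg2⟩ := (hmem g).1 hg
      obtain ⟨hh1, hh2⟩ := (hmem h).1 hh
      beta_reduce
      rw [dif_pos hg1, dif_pos hh1, dif_pos (H.mul_mem hg1 hh1)]
      exact hm ⟨g, hg1⟩ ⟨h, hh1⟩ hg2 hh2
    · intro h hh
      obtain ⟨hh1, hh2⟩ := (hmem h).1 hh
      beta_reduce
      rw [dif_pos hh1]
      exact congrArg Subtype.val (hχv ⟨h, hh1⟩ hh2)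
    · have hc : Nat.card {g : G // e g ∈ B'.map (NonUnitalSubalgebraClass.subtype B)} =
          Nat.card {h : H // e' h ∈ B'} := by
        refine Nat.card_congr
          { toFun := fun g => ⟨⟨g.1, ((hmem g.1).1 g.2).1⟩, ((hmem g.1).1 g.2).2⟩
            invFun := fun h => ⟨h.1.1, (hmem _).2 ⟨h.1.2, h.2⟩⟩
            left_inv := fun _ => rfl
            right_inv := fun _ => rfl }
      rw [hc, hrank, mul_left_comm, hcard, Subgroup.index_mul_card]

/-- The Gutkin–Halasi theorem.  Let `A` be a finite-dimensional associative nilpotent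
algebra over a finite field `F`, and let `G` be the algebra group `A^×` (a group with a
bijection `e : G ≃ A` identifying the multiplication with `x ∘ y = x + y + x·y` and the
identity with `0`).  Then every irreducible complex representation `ρ` of `G` is induced
from a one-dimensional representation `χ` of a subgroup of the form `B^×` for an
`F`-subalgebra `B ⊆ A`.  Being induced from the character `χ` of the subgroup
`B^× = e⁻¹(B)` is recorded by the two standard equivalent conditions: `V` contains a
nonzero `χ`-eigenvector for `B^×`, and `dim V · |B^×| = |A^×|`. -/
theorem gutkin_halasi
    (F : Type*) [Field F] [Fintype F]
    (A : Type*) [NonUnitalRing A] [Module F A]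
    [IsScalarTower F A A] [SMulCommClass F A A] [FiniteDimensional F A]
    (hnil : ∀ a : A, ∃ k : ℕ, nupow a k = 0)
    (G : Type*) [Group G] (e : G ≃ A)
    (he1 : e 1 = 0)
    (hemul : ∀ g h : G, e (g * h) = e g + e h + e g * e h)
    (V : Type*) [AddCommGroup V] [Module ℂ V] [FiniteDimensional ℂ V]
    (ρ : G →* (V →ₗ[ℂ] V)) (hirr : IsIrreducibleRep ρ) :
    ∃ (B : NonUnitalSubalgebra F A) (χ : G → ℂˣ),
      (∀ g h : G, e g ∈ B → e h ∈ B → χ (g * h) = χ g * χ h) ∧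
      (∃ v : V, v ≠ 0 ∧ ∀ h : G, e h ∈ B → ρ h v = ((χ h : ℂˣ) : ℂ) • v) ∧
      Nat.card {g : G // e g ∈ B} * Module.finrank ℂ V = Nat.card G := by
  exact gh_main F _ A rfl G e he1 hemul V ρ hirr
end

section
/- Let F be a finite field of odd characteristic with q = |F| elements, let A be a finite-dimensional associative (not necessarily unital) F-algebra in which every element is nilpotent, and let σ : A → A be an F-linear anti-involution (σ(xy) = σ(y)σ(x), σ² = id). Then the set Sp(A, σ) := {x ∈ A : x + σ(x) + x·σ(x) = 0} is a subgroup of the algebra group A^×, and the dimension of every irreducible finite-dimensional complex representation of Sp(A, σ) is a power of q. -/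
section RepPart

variable {Γ V : Type*} [Group Γ] [AddCommGroup V] [Module ℂ V] [FiniteDimensional ℂ V]

/-- `W` is an irreducible `H`-stable subspace. -/
def IrrOn (ρ : Γ → V →ₗ[ℂ] V) (H : Subgroup Γ) (W : Submodule ℂ V) : Prop :=
  W ≠ ⊥ ∧ (∀ h ∈ H, ∀ w ∈ W, ρ h w ∈ W) ∧
    ∀ W' ≤ W, (∀ h ∈ H, ∀ w ∈ W', ρ h w ∈ W') → W' = ⊥ ∨ W' = W

lemma exists_eig (W : Submodule ℂ V) (hW : W ≠ ⊥) (T : V →ₗ[ℂ] V)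
    (hT : ∀ w ∈ W, T w ∈ W) : ∃ a : ℂ, ∃ w ∈ W, w ≠ 0 ∧ T w = a • w := by
  have : Nontrivial W := Submodule.nontrivial_iff_ne_bot.mpr hW
  obtain ⟨a, ha⟩ := Module.End.exists_eigenvalue (T.restrict hT : Module.End ℂ W)
  obtain ⟨w, hw⟩ := ha.exists_hasEigenvector
  refine ⟨a, w, w.2, fun h => hw.2 (Subtype.ext h), ?_⟩
  have := congrArg Subtype.val hw.apply_eq_smul
  simpa using this

/-- The `a`-eigenspace of `T` in `W`. -/
def eigIn (W : Submodule ℂ V) (T : V →ₗ[ℂ] V) (a : ℂ) : Submodule ℂ V :=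
  W ⊓ LinearMap.ker (T - a • LinearMap.id)

lemma mem_eigIn {W : Submodule ℂ V} {T : V →ₗ[ℂ] V} {a : ℂ} {w : V} :
    w ∈ eigIn W T a ↔ w ∈ W ∧ T w = a • w := by
  simp [eigIn, sub_eq_zero]

lemma schur_on {ρ : Γ → V →ₗ[ℂ] V} {H : Subgroup Γ} {W : Submodule ℂ V} (hW : IrrOn ρ H W)
    (T : V →ₗ[ℂ] V) (hT : ∀ w ∈ W, T w ∈ W)
    (hc : ∀ h ∈ H, ∀ w ∈ W, T (ρ h w) = ρ h (T w)) : ∃ a : ℂ, ∀ w ∈ W, T w = a • w := by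
  obtain ⟨h0, h1, h2⟩ := hW
  obtain ⟨a, w, hw, hw0, hwa⟩ := exists_eig W h0 T hT
  refine ⟨a, ?_⟩
  have := h2 (eigIn W T a) inf_le_left (by
    intro h hh v hv
    rw [mem_eigIn] at hv ⊢
    refine ⟨h1 h hh v hv.1, ?_⟩
    rw [hc h hh v hv.1, hv.2, map_smul])
  rcases this with h | h
  · exfalso
    have hm : w ∈ eigIn W T a := mem_eigIn.mpr ⟨hw, hwa⟩
    rw [h] at hm
    exact hw0 (by simpa using hm)
  · intro v hv
    rw [← h] at hv
    exact (mem_eigIn.mp hv).2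

lemma joint_eig {ι : Type*} (f : ι → V →ₗ[ℂ] V) (n : ℕ) : ∀ (W : Submodule ℂ V),
    Module.finrank ℂ W = n → W ≠ ⊥ →
    (∀ i, ∀ w ∈ W, f i w ∈ W) → (∀ i j, ∀ w ∈ W, f i (f j w) = f j (f i w)) →
    ∃ χ : ι → ℂ, ∃ w ∈ W, w ≠ 0 ∧ ∀ i, f i w = χ i • w := by
  induction n using Nat.strong_induction_on with
  | _ n ih =>
  intro W hn hW hinv hcomm
  by_cases hsc : ∀ i, ∃ a : ℂ, ∀ w ∈ W, f i w = a • w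
  · choose χ hχ using hsc
    obtain ⟨w, hw, hw0⟩ := Submodule.exists_mem_ne_zero_of_ne_bot hW
    exact ⟨χ, w, hw, hw0, fun i => hχ i w hw⟩
  · push Not at hsc
    obtain ⟨i, hi⟩ := hsc
    obtain ⟨a, w, hw, hw0, hwa⟩ := exists_eig W hW (f i) (hinv i)
    have hlt : eigIn W (f i) a < W := by
      refine lt_of_le_of_ne inf_le_left ?_
      intro h
      obtain ⟨v, hv, hva⟩ := hi a
      rw [← h] at hv
      exact hva (mem_eigIn.mp hv).2
    obtain ⟨χ, v, hv, hv0, hvχ⟩ := ih _ (hn ▸ Submodule.finrank_lt_finrank_of_lt hlt)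
      (eigIn W (f i) a) rfl
      (by
        intro h
        have hm : w ∈ eigIn W (f i) a := mem_eigIn.mpr ⟨hw, hwa⟩
        rw [h] at hm
        exact hw0 (by simpa using hm))
      (by
        intro j v hv
        rw [mem_eigIn] at hv ⊢
        refine ⟨hinv j v hv.1, ?_⟩
        rw [hcomm i j v hv.1, hv.2, map_smul])
      (fun j k v hv => hcomm j k v (mem_eigIn.mp hv).1)
    exact ⟨χ, v, hlt.le hv, hv0, hvχ⟩

lemma eig_indep {ι κ : Type*} (f : ι → V →ₗ[ℂ] V) (χ : κ → ι → ℂ)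
    (hχ : ∀ c d, (∀ i, χ c i = χ d i) → c = d) (S : Finset κ) :
    ∀ v : κ → V, (∀ c i, f i (v c) = χ c i • v c) → ∑ c ∈ S, v c = 0 → ∀ c ∈ S, v c = 0 := by
  classical
  induction S using Finset.induction_on with
  | empty => simp
  | insert d S hd ih =>
    intro v hv hsum
    rw [Finset.sum_insert hd] at hsum
    have key : ∀ c ∈ S, v c = 0 := by
      intro c hc
      obtain ⟨i, hi⟩ : ∃ i, χ c i ≠ χ d i := by
        by_contra hcon
        push Not at hcon
        exact hd (hχ c d hcon ▸ hc)
      have h1 := ih (fun c => (χ c i - χ d i) • v c)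
        (by intro c j; simp only [map_smul, hv]; rw [smul_comm])
        (by
          have h2 : f i (v d + ∑ c ∈ S, v c) = 0 := by rw [hsum, map_zero]
          rw [map_add, map_sum, hv] at h2
          simp only [hv] at h2
          simp only [sub_smul, Finset.sum_sub_distrib, ← Finset.smul_sum]
          have h3 : ∑ c ∈ S, v c = - v d := by rw [← add_eq_zero_iff_neg_eq.mp hsum]
          rw [h3, smul_neg, sub_neg_eq_add, add_comm]
          exact h2) c hc
      exact (smul_eq_zero.mp h1).resolve_left (sub_ne_zero.mpr hi)
    intro c hc
    rcases Finset.mem_insert.mp hc with rfl | hc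
    · rw [Finset.sum_eq_zero key, add_zero] at hsum
      exact hsum
    · exact key c hc

lemma clifford_on [Finite Γ] {ι : Type*} {ρ : Γ → V →ₗ[ℂ] V} {H L : Subgroup Γ}
    {W : Submodule ℂ V} (hW : IrrOn ρ H W) (hρ1 : ρ 1 = LinearMap.id)
    (hρ : ∀ g ∈ H, ∀ h ∈ H, ρ (g * h) = ρ g ∘ₗ ρ h) (hLH : L ≤ H)
    (s : ι → Γ) (hs : ∀ i, s i ∈ L) (c : Γ → ι → ℂ)
    (hcm : ∀ g ∈ H, ∀ h ∈ H, ∀ i, c (g * h) i = c g i * c h i)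
    (hc : ∀ h ∈ H, ∀ i, ∀ w ∈ W, ρ (h * s i * h⁻¹) w = c h i • ρ (s i) w)
    (hL : ∀ h ∈ H, (∀ i, c h i = 1) ↔ h ∈ L) :
    ∃ W0 ≤ W, IrrOn ρ L W0 ∧
      Module.finrank ℂ W = L.relIndex H * Module.finrank ℂ W0 := by
  classical
  obtain ⟨hWne, hWinv, hWirr⟩ := hW
  have hsH : ∀ i, s i ∈ H := fun i => hLH (hs i)
  have hmul : ∀ g ∈ H, ∀ h ∈ H, ∀ v, ρ (g * h) v = ρ g (ρ h v) := by
    intro g hg h hh v; rw [hρ g hg h hh]; rfl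
  have hinvv : ∀ g ∈ H, ∀ v, ρ g⁻¹ (ρ g v) = v := by
    intro g hg v
    rw [← hmul _ (H.inv_mem hg) _ hg, inv_mul_cancel, hρ1]; rfl
  -- moving `s i` past `h`
  have hmove : ∀ h ∈ H, ∀ i, ∀ w ∈ W, ρ (s i) (ρ h w) = c h⁻¹ i • ρ h (ρ (s i) w) := by
    intro h hh i w hw
    have h1 := hc h⁻¹ (H.inv_mem hh) i w hw
    rw [← map_smul, ← h1, inv_inv, ← hmul _ (hsH i) _ hh, ← hmul _ hh _
      (H.mul_mem (H.mul_mem (H.inv_mem hh) (hsH i)) hh)]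
    congr 2
    group
  have hc1 : ∀ i, c 1 i = 1 := (hL 1 H.one_mem).mpr L.one_mem
  obtain ⟨χ, w0, hw0, hw00, hw0χ⟩ := joint_eig (fun i => ρ (s i)) _ W rfl hWne
    (fun i w hw => hWinv _ (hsH i) w hw)
    (by
      intro i j w hw
      show ρ (s i) (ρ (s j) w) = ρ (s j) (ρ (s i) w)
      rw [hmove (s j) (hsH j) i w hw, (hL _ (H.inv_mem (hsH j))).mpr (L.inv_mem (hs j)) i, one_smul])
  have hχ0 : ∀ i, χ i ≠ 0 := by
    intro i h0
    have h1 := hw0χ i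
    simp only [h0, zero_smul] at h1
    have h2 := hinvv (s i) (hsH i) w0
    rw [h1, map_zero] at h2
    exact hw00 h2.symm
  let W0 : Submodule ℂ V :=
    { carrier := {w | w ∈ W ∧ ∀ i, ρ (s i) w = χ i • w}
      add_mem' := by
        rintro a b ⟨ha, ha'⟩ ⟨hb, hb'⟩
        exact ⟨W.add_mem ha hb, fun i => by rw [map_add, ha', hb', smul_add]⟩
      zero_mem' := ⟨W.zero_mem, fun i => by simp⟩
      smul_mem' := by
        rintro r a ⟨ha, ha'⟩
        exact ⟨W.smul_mem r ha, fun i => by rw [map_smul, ha', smul_comm]⟩ }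
  have hW0W : W0 ≤ W := fun w hw => hw.1
  have hW0χ : ∀ w ∈ W0, ∀ i, ρ (s i) w = χ i • w := fun w hw => hw.2
  have hW0ne : W0 ≠ ⊥ := by
    intro h
    have : w0 ∈ W0 := ⟨hw0, hw0χ⟩
    rw [h] at this
    exact hw00 (by simpa using this)
  have hW0L : ∀ h ∈ L, ∀ w ∈ W0, ρ h w ∈ W0 := by
    intro h hh w hw
    refine ⟨hWinv h (hLH hh) w hw.1, fun i => ?_⟩
    rw [hmove h (hLH hh) i w hw.1, (hL _ (H.inv_mem (hLH hh))).mpr (L.inv_mem hh) i, one_smul,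
      hw.2 i, map_smul]
  let Q := ↥H ⧸ L.subgroupOf H
  have : Fintype Q := Fintype.ofFinite Q
  let r : Q → Γ := fun q => (q.out : ↥H).1
  have hrH : ∀ q, r q ∈ H := fun q => (q.out : ↥H).2
  have hcard : Fintype.card Q = L.relIndex H := by
    rw [← Nat.card_eq_fintype_card]; rfl
  have hdist : ∀ q q' : Q, (∀ i, c (r q)⁻¹ i * χ i = c (r q')⁻¹ i * χ i) → q = q' := by
    intro q q' h
    have h1 : (r q)⁻¹ * r q' ∈ L := by
      rw [← hL _ (H.mul_mem (H.inv_mem (hrH q)) (hrH q'))]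
      intro i
      rw [hcm _ (H.inv_mem (hrH q)) _ (hrH q'), mul_right_cancel₀ (hχ0 i) (h i),
        ← hcm _ (H.inv_mem (hrH q')) _ (hrH q'), inv_mul_cancel, hc1]
    rw [← QuotientGroup.out_eq' q, ← QuotientGroup.out_eq' q', QuotientGroup.eq]
    exact h1
  have hdim : ∀ W' ≤ W0, W' ≠ ⊥ → (∀ h ∈ L, ∀ w ∈ W', ρ h w ∈ W') →
      Module.finrank ℂ W = L.relIndex H * Module.finrank ℂ W' := by
    intro W' hle hne hinv
    let T : (Q → W') →ₗ[ℂ] V := ∑ q : Q, (ρ (r q) ∘ₗ W'.subtype) ∘ₗ LinearMap.proj q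
    have hT : ∀ x, T x = ∑ q, ρ (r q) (x q) := by
      intro x; simp [T]
    have hTinj : Function.Injective T := by
      rw [← LinearMap.ker_eq_bot, LinearMap.ker_eq_bot']
      intro x hx
      rw [hT] at hx
      have h1 := eig_indep (fun i => ρ (s i)) (fun q i => c (r q)⁻¹ i * χ i) hdist Finset.univ
        (fun q => ρ (r q) (x q))
        (by
          intro q i
          show ρ (s i) (ρ (r q) (x q)) = _
          rw [hmove _ (hrH q) i _ (hW0W (hle (x q).2)), hW0χ _ (hle (x q).2) i, map_smul, smul_smul])
        hx
      funext q
      have h2 := h1 q (Finset.mem_univ q)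
      have h3 := hinvv _ (hrH q) (x q : V)
      rw [h2, map_zero] at h3
      exact Subtype.ext h3.symm
    have hrange : LinearMap.range T = W := by
      have hleW : LinearMap.range T ≤ W := by
        rintro _ ⟨x, rfl⟩
        rw [hT]
        exact W.sum_mem fun q _ => hWinv _ (hrH q) _ (hW0W (hle (x q).2))
      have hpiece : ∀ q : Q, ∀ w ∈ W', ρ (r q) w ∈ LinearMap.range T := by
        intro q w hw
        refine ⟨Pi.single q ⟨w, hw⟩, ?_⟩
        rw [hT, Finset.sum_eq_single q]
        · simp
        · intro q' _ hq'
          simp [Pi.single_eq_of_ne hq']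
        · simp
      rcases hWirr _ hleW (by
        rintro h hh _ ⟨x, rfl⟩
        rw [hT, map_sum]
        refine Submodule.sum_mem _ fun q _ => ?_
        let q' : Q := ((⟨h, hh⟩ * q.out : ↥H) : Q)
        have hl : (r q')⁻¹ * (h * r q) ∈ L := by
          have h1 : ((q'.out : ↥H) : Q) = ((⟨h, hh⟩ * q.out : ↥H) : Q) := QuotientGroup.out_eq' q'
          have h3 := QuotientGroup.eq.mp h1
          exact h3
        have h2 : ρ h (ρ (r q) (x q)) = ρ (r q') (ρ ((r q')⁻¹ * (h * r q)) (x q)) := by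
          rw [← hmul _ hh _ (hrH q), ← hmul _ (hrH q') _ (hLH hl), mul_inv_cancel_left]
        rw [h2]
        exact hpiece q' _ (hinv _ hl _ (x q).2)) with h | h
      · exfalso
        obtain ⟨w, hw, hw0⟩ := Submodule.exists_mem_ne_zero_of_ne_bot hne
        have h1 := hpiece ((1 : ↥H) : Q) w hw
        rw [h] at h1
        have h1 : ρ (r ((1 : ↥H) : Q)) w = 0 := by simpa using h1
        have h3 := hinvv _ (hrH ((1 : ↥H) : Q)) w
        rw [h1, map_zero] at h3
        exact hw0 h3.symm
      · exact h
    rw [← hrange, LinearMap.finrank_range_of_inj hTinj, Module.finrank_pi_fintype]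
    simp [hcard]
  refine ⟨W0, hW0W, ⟨hW0ne, hW0L, ?_⟩, hdim W0 le_rfl hW0ne hW0L⟩
  intro W' hle hinv
  by_cases hne : W' = ⊥
  · exact Or.inl hne
  · right
    apply Submodule.eq_of_le_of_finrank_eq hle
    have h1 := hdim W' hle hne hinv
    have h2 := hdim W0 le_rfl hW0ne hW0L
    have h3 : 0 < L.relIndex H := by
      rw [← hcard]; exact Fintype.card_pos
    exact Nat.eq_of_mul_eq_mul_left h3 (h1.symm.trans h2)

end RepPart


section AlgPart

set_option linter.unusedSectionVars false

variable {F R : Type*} [Field F] [Ring R] [Algebra F R] [Finite R]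

/-- A nilpotent subalgebra (without unit) of `R`. -/
structure NilAlg (J : Submodule F R) : Prop where
  mul : J * J ≤ J
  nil : ∃ N, J ^ N = ⊥

/-- The unit `1 + x`, if it is one. -/
noncomputable def oneAdd (x : R) : Rˣ := by
  classical exact if h : IsUnit (1 + x) then h.unit else 1

/-- `g ∈ 1 + J ^ m`. -/
def InG (J : Submodule F R) (m : ℕ) (g : Rˣ) : Prop := (g : R) - 1 ∈ J ^ m

namespace NilAlg

variable {J : Submodule F R}

lemma pow_le (hJ : NilAlg J) {a b : ℕ} (ha : 1 ≤ a) (hab : a ≤ b) : J ^ b ≤ J ^ a := by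
  induction b, hab using Nat.le_induction with
  | base => exact le_rfl
  | succ b hb ih =>
    refine le_trans ?_ ih
    obtain ⟨c, rfl⟩ : ∃ c, b = c + 1 := ⟨b - 1, by omega⟩
    calc J ^ (c + 1 + 1) = J ^ c * (J * J) := by rw [pow_succ, pow_succ, mul_assoc]
      _ ≤ J ^ c * J := by gcongr; exact hJ.mul
      _ = J ^ (c + 1) := (pow_succ _ _).symm

lemma mul_mem' {a b : ℕ} {x y : R} (hx : x ∈ J ^ a) (hy : y ∈ J ^ b) : x * y ∈ J ^ (a + b) := by
  rw [pow_add]; exact Submodule.mul_mem_mul hx hy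

lemma mul_mem_of (hJ : NilAlg J) {a b c : ℕ} {x y : R} (hx : x ∈ J ^ a) (hy : y ∈ J ^ b)
    (hc : 1 ≤ c) (h : c ≤ a + b) : x * y ∈ J ^ c :=
  hJ.pow_le hc h (mul_mem' hx hy)

lemma isNilpotent (hJ : NilAlg J) {x : R} (hx : x ∈ J) : IsNilpotent x := by
  obtain ⟨N, hN⟩ := hJ.nil
  refine ⟨N, ?_⟩
  have := Submodule.pow_mem_pow J hx N
  rw [hN] at this
  simpa using this

lemma coe_oneAdd (hJ : NilAlg J) {x : R} (hx : x ∈ J) : (oneAdd x : R) = 1 + x := by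
  have h : IsUnit (1 + x) := (hJ.isNilpotent hx).isUnit_one_add
  simp [oneAdd, h]

lemma mem_one (hJ : NilAlg J) {m : ℕ} (hm : 1 ≤ m) {x : R} (hx : x ∈ J ^ m) : x ∈ J := by
  have := hJ.pow_le le_rfl hm hx
  simpa using this

lemma inG_oneAdd (hJ : NilAlg J) {m : ℕ} (hm : 1 ≤ m) {x : R} (hx : x ∈ J ^ m) :
    InG J m (oneAdd x) := by
  unfold InG
  rw [hJ.coe_oneAdd (hJ.mem_one hm hx)]
  simpa using hx

end NilAlg

namespace InG

variable {J : Submodule F R} {m : ℕ} {g h : Rˣ}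

lemma one : InG J m 1 := by simp [InG]

lemma mono (hJ : NilAlg J) {k : ℕ} (hk : 1 ≤ k) (hkm : k ≤ m) (hg : InG J m g) : InG J k g :=
  hJ.pow_le hk hkm hg

lemma mem (hJ : NilAlg J) (hm : 1 ≤ m) (hg : InG J m g) : (g : R) - 1 ∈ J := hJ.mem_one hm hg

lemma mul (hJ : NilAlg J) (hm : 1 ≤ m) (hg : InG J m g) (hh : InG J m h) : InG J m (g * h) := by
  unfold InG at *
  have : ((g * h : Rˣ) : R) - 1 = (g - 1) + (h - 1) + (g - 1) * (h - 1) := by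
    push_cast; noncomm_ring
  rw [this]
  exact add_mem (add_mem hg hh) (hJ.mul_mem_of hg hh hm (by omega))

lemma pow (hJ : NilAlg J) (hm : 1 ≤ m) (hg : InG J m g) (k : ℕ) : InG J m (g ^ k) := by
  induction k with
  | zero => simpa using one
  | succ k ih => rw [pow_succ]; exact ih.mul hJ hm hg

lemma inv (hJ : NilAlg J) (hm : 1 ≤ m) (hg : InG J m g) : InG J m g⁻¹ := by
  have : g⁻¹ = g ^ (orderOf g - 1) := by
    rw [eq_comm, ← mul_eq_one_iff_eq_inv, ← pow_succ, Nat.sub_add_cancel (orderOf_pos g),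
      pow_orderOf_eq_one]
  rw [this]
  exact hg.pow hJ hm _

lemma mul_mem_right (hJ : NilAlg J) {k : ℕ} (hk : 1 ≤ k) {w : R} (hw : w ∈ J ^ k)
    (hg : InG J 1 g) : w * g ∈ J ^ k := by
  have : w * g = w + w * (g - 1) := by noncomm_ring
  rw [this]
  exact add_mem hw (hJ.mul_mem_of hw hg hk (by omega))

lemma mul_mem_left (hJ : NilAlg J) {k : ℕ} (hk : 1 ≤ k) {w : R} (hw : w ∈ J ^ k)
    (hg : InG J 1 g) : g * w ∈ J ^ k := by
  have : g * w = w + (g - 1) * w := by noncomm_ring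
  rw [this]
  exact add_mem hw (hJ.mul_mem_of hg hw hk (by omega))

lemma ratio (hJ : NilAlg J) {k : ℕ} (hk : 1 ≤ k) (hg : InG J 1 g)
    (hgh : (h : R) - g ∈ J ^ k) : InG J k (g⁻¹ * h) := by
  unfold InG
  have : ((g⁻¹ * h : Rˣ) : R) - 1 = (g⁻¹ : Rˣ) * ((h : R) - g) := by
    rw [mul_sub, Units.inv_mul]; simp
  rw [this]
  exact mul_mem_left hJ hk hgh (hg.inv hJ le_rfl)

lemma conj (hJ : NilAlg J) {k : ℕ} (hk : 1 ≤ k) (hh : InG J k h) (hg : InG J 1 g) :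
    InG J k (g * h * g⁻¹) := by
  unfold InG
  have : ((g * h * g⁻¹ : Rˣ) : R) - 1 = g * ((h : R) - 1) * (g⁻¹ : Rˣ) := by
    rw [mul_sub, sub_mul]; simp
  rw [this]
  exact mul_mem_right hJ hk (mul_mem_left hJ hk hh hg) (hg.inv hJ le_rfl)

lemma comm (hJ : NilAlg J) {k : ℕ} (hk : 1 ≤ k) (hg : InG J 1 g) (hh : InG J k h) :
    InG J (k + 1) (g * h * g⁻¹ * h⁻¹) := by
  unfold InG
  have h2 : (g : R) * h - h * g = (g - 1) * (h - 1) - (h - 1) * (g - 1) := by noncomm_ring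
  have : ((g * h * g⁻¹ * h⁻¹ : Rˣ) : R) - 1 = (g * h - h * g) * (g⁻¹ : Rˣ) * (h⁻¹ : Rˣ) := by
    rw [sub_mul, sub_mul, mul_assoc (h : R)]; simp
  rw [this, h2]
  refine mul_mem_right hJ (by omega) (mul_mem_right hJ (by omega) (sub_mem ?_ ?_)
    (hg.inv hJ le_rfl)) ((hh.mono hJ le_rfl hk).inv hJ le_rfl)
  · exact hJ.mul_mem_of hg hh (by omega) (by omega)
  · exact hJ.mul_mem_of hh hg (by omega) (by omega)

end InG

/-- A `1 + J`-invariant linear character of `1 + J ^ n`. -/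
structure IChar (J : Submodule F R) (n : ℕ) (ψ : Rˣ → ℂ) : Prop where
  one : ψ 1 = 1
  mul : ∀ g h, InG J n g → InG J n h → ψ (g * h) = ψ g * ψ h
  conj : ∀ g h, InG J 1 g → InG J n h → ψ (g * h * g⁻¹) = ψ h

/-- The commutator pairing. -/
def cc (ψ : Rˣ → ℂ) (g h : Rˣ) : ℂ := ψ (g * h * g⁻¹ * h⁻¹)

namespace IChar

variable {J : Submodule F R} {m : ℕ} {ψ : Rˣ → ℂ}

lemma mul_inv (hJ : NilAlg J) {n : ℕ} (hn : 1 ≤ n) (hψ : IChar J n ψ) {g : Rˣ} (hg : InG J n g) :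
    ψ g * ψ g⁻¹ = 1 := by
  rw [← hψ.mul _ _ hg (hg.inv hJ hn), mul_inv_cancel, hψ.one]

lemma ne_zero (hJ : NilAlg J) {n : ℕ} (hn : 1 ≤ n) (hψ : IChar J n ψ) {g : Rˣ} (hg : InG J n g) :
    ψ g ≠ 0 := left_ne_zero_of_mul_eq_one (hψ.mul_inv hJ hn hg)

lemma inv (hJ : NilAlg J) {n : ℕ} (hn : 1 ≤ n) (hψ : IChar J n ψ) {g : Rˣ} (hg : InG J n g) :
    ψ g⁻¹ = (ψ g)⁻¹ := eq_inv_of_mul_eq_one_right (hψ.mul_inv hJ hn hg)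

lemma cc_mul_left (hJ : NilAlg J) (hm : 1 ≤ m) (hψ : IChar J (m + 1) ψ) {g g' h : Rˣ}
    (hg : InG J 1 g) (hg' : InG J 1 g') (hh : InG J m h) :
    cc ψ (g * g') h = cc ψ g h * cc ψ g' h := by
  have e : g * g' * h * (g * g')⁻¹ * h⁻¹ =
      (g * (g' * h * g'⁻¹ * h⁻¹) * g⁻¹) * (g * h * g⁻¹ * h⁻¹) := by group
  unfold cc
  rw [e, hψ.mul _ _ ((hg'.comm hJ hm hh).conj hJ (by omega) hg) (hg.comm hJ hm hh),
    hψ.conj _ _ hg (hg'.comm hJ hm hh), mul_comm]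

lemma cc_mul_right (hJ : NilAlg J) (hm : 1 ≤ m) (hψ : IChar J (m + 1) ψ) {g h h' : Rˣ}
    (hg : InG J 1 g) (hh : InG J m h) (hh' : InG J m h') :
    cc ψ g (h * h') = cc ψ g h * cc ψ g h' := by
  have e : g * (h * h') * g⁻¹ * (h * h')⁻¹ =
      (g * h * g⁻¹ * h⁻¹) * (h * (g * h' * g⁻¹ * h'⁻¹) * h⁻¹) := by group
  have h1 : InG J 1 h := hh.mono hJ le_rfl hm
  unfold cc
  rw [e, hψ.mul _ _ (hg.comm hJ hm hh) ((hg.comm hJ hm hh').conj hJ (by omega) h1),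
    hψ.conj _ _ h1 (hg.comm hJ hm hh')]

lemma cc_right_one (hJ : NilAlg J) (hψ : IChar J (m + 1) ψ) {g h : Rˣ}
    (hg : InG J 1 g) (hh : InG J (m + 1) h) : cc ψ g h = 1 := by
  unfold cc
  rw [hψ.mul _ _ (hh.conj hJ (by omega) hg) (hh.inv hJ (by omega)), hψ.conj _ _ hg hh,
    hψ.mul_inv hJ (by omega) hh]

lemma cc_congr_right (hJ : NilAlg J) (hm : 1 ≤ m) (hψ : IChar J (m + 1) ψ) {g h h' : Rˣ}
    (hg : InG J 1 g) (hh : InG J m h) (hd : (h' : R) - h ∈ J ^ (m + 1)) :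
    cc ψ g h' = cc ψ g h := by
  have h1 : InG J (m + 1) (h⁻¹ * h') := InG.ratio hJ (by omega) (hh.mono hJ le_rfl hm) hd
  have e : h' = h * (h⁻¹ * h') := by group
  rw [e, hψ.cc_mul_right hJ hm hg hh (h1.mono hJ hm (by omega)), hψ.cc_right_one hJ hg h1, mul_one]

/-- The key identity. -/
lemma cc_key (hJ : NilAlg J) (hm : 1 ≤ m) (hψ : IChar J (m + 1) ψ) {x z : R}
    (hx : x ∈ J) (hz : z ∈ J ^ m) :
    cc ψ (oneAdd x) (oneAdd z) * ψ (oneAdd (z * x)) = ψ (oneAdd (x * z)) := by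
  have hx1 : x ∈ J ^ 1 := by simpa using hx
  have hzJ := hJ.mem_one hm hz
  have hzx : z * x ∈ J ^ (m + 1) := hJ.mul_mem_of hz hx1 (by omega) (by omega)
  have hxz : x * z ∈ J ^ (m + 1) := hJ.mul_mem_of hx1 hz (by omega) (by omega)
  have hu : InG J 1 (oneAdd x) := hJ.inG_oneAdd le_rfl hx1
  have hw : InG J m (oneAdd (-z)) := hJ.inG_oneAdd hm (neg_mem hz)
  have hw1 : InG J 1 (oneAdd (-z)) := hw.mono hJ le_rfl hm
  have hA : InG J (m + 1) (oneAdd (z * x)) := hJ.inG_oneAdd (by omega) hzx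
  have hB : InG J (m + 1) (oneAdd (x * z)) := hJ.inG_oneAdd (by omega) hxz
  have cu : (oneAdd x : R) = 1 + x := hJ.coe_oneAdd hx
  have cw : (oneAdd (-z) : R) = 1 + -z := hJ.coe_oneAdd (neg_mem hzJ)
  have cA : (oneAdd (z * x) : R) = 1 + z * x := hJ.coe_oneAdd (hJ.mem_one (by omega) hzx)
  have cB : (oneAdd (x * z) : R) = 1 + x * z := hJ.coe_oneAdd (hJ.mem_one (by omega) hxz)
  have cz : (oneAdd z : R) = 1 + z := hJ.coe_oneAdd hzJ
  generalize oneAdd x = u at *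
  generalize oneAdd (z * x) = A at *
  generalize oneAdd (x * z) = B at *
  generalize oneAdd (-z) = w at *
  -- the identity `u w⁻¹ A = B w⁻¹ u`
  have e1 : u * (w⁻¹ * A) = B * w⁻¹ * u := by
    apply Units.ext
    push_cast
    have v1 : (↑w⁻¹ : R) * z = ↑w⁻¹ - 1 := by
      have : (↑w⁻¹ : R) * w = 1 := Units.inv_mul w
      rw [cw, mul_add, mul_one, mul_neg, ← sub_eq_add_neg] at this
      rw [← this]; abel
    have v2 : z * (↑w⁻¹ : R) = ↑w⁻¹ - 1 := by
      have : (w : R) * ↑w⁻¹ = 1 := Units.mul_inv w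
      rw [cw, add_mul, one_mul, neg_mul, ← sub_eq_add_neg] at this
      rw [← this]; abel
    rw [cu, cA, cB]
    have l : (↑w⁻¹ : R) * (1 + z * x) = ↑w⁻¹ + (↑w⁻¹ - 1) * x := by
      rw [mul_add, mul_one, ← mul_assoc, v1]
    have r : (1 + x * z) * (↑w⁻¹ : R) = ↑w⁻¹ + x * (↑w⁻¹ - 1) := by
      rw [add_mul, one_mul, mul_assoc, v2]
    rw [l, r]
    noncomm_ring
  have e2 : u * (w⁻¹ * A) * u⁻¹ * (w⁻¹ * A)⁻¹ = B * (w⁻¹ * A⁻¹ * (w⁻¹)⁻¹) := by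
    rw [e1]; group
  have e3 : cc ψ u (w⁻¹ * A) = ψ B * (ψ A)⁻¹ := by
    unfold cc
    rw [e2, hψ.mul _ _ hB ((hA.inv hJ (by omega)).conj hJ (by omega) (hw1.inv hJ le_rfl)),
      hψ.conj _ _ (hw1.inv hJ le_rfl) (hA.inv hJ (by omega)), hψ.inv hJ (by omega) hA]
  rw [hψ.cc_mul_right hJ hm hu (hw.inv hJ hm) (hA.mono hJ hm (by omega)),
    hψ.cc_right_one hJ hu hA, mul_one] at e3
  have e4 : cc ψ u (oneAdd z) = cc ψ u w⁻¹ := by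
    apply hψ.cc_congr_right hJ hm hu (hw.inv hJ hm)
    rw [cz]
    have : (1 + z - ↑w⁻¹ : R) = -(z * z) * ↑w⁻¹ := by
      have h1 : (w : R) * ↑w⁻¹ = 1 := Units.mul_inv w
      calc (1 + z - ↑w⁻¹ : R) = (1 + z) * (w * ↑w⁻¹) - ↑w⁻¹ := by rw [h1, mul_one]
        _ = _ := by rw [cw]; noncomm_ring
    rw [this]
    exact InG.mul_mem_right hJ (by omega) (neg_mem (hJ.mul_mem_of hz hz (by omega) (by omega)))
      (hw1.inv hJ le_rfl)
  rw [e4, e3, inv_mul_cancel_right₀ (hψ.ne_zero hJ (by omega) hA)]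

/-- The pairing in additive coordinates. -/
noncomputable def gam (ψ : Rˣ → ℂ) (x z : R) : ℂ := cc ψ (oneAdd x) (oneAdd z)

lemma gam_smul (hJ : NilAlg J) (hm : 1 ≤ m) (hψ : IChar J (m + 1) ψ) (a : F) {x z : R}
    (hx : x ∈ J) (hz : z ∈ J ^ m) : gam ψ (a • x) z = gam ψ x (a • z) := by
  have h1 := hψ.cc_key hJ hm (J.smul_mem a hx) hz
  have h2 := hψ.cc_key hJ hm hx ((J ^ m).smul_mem a hz)
  rw [mul_smul_comm, smul_mul_assoc] at h1 h2
  have hx1 : x ∈ J ^ 1 := by simpa using hx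
  have hA : InG J (m + 1) (oneAdd (a • (z * x))) := hJ.inG_oneAdd (by omega)
    (Submodule.smul_mem _ a (hJ.mul_mem_of hz hx1 (by omega) (by omega)))
  exact mul_right_cancel₀ (hψ.ne_zero hJ (by omega) hA) (h1.trans h2.symm)

lemma cyc (hJ : NilAlg J) (hm : 1 ≤ m) (hψ : IChar J (m + 1) ψ) {x z : R}
    (hx : x ∈ J) (hz : z ∈ J ^ (m + 1)) : ψ (oneAdd (z * x)) = ψ (oneAdd (x * z)) := by
  have h1 := hψ.cc_key hJ hm hx (hJ.pow_le hm (by omega) hz)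
  have hx1 : x ∈ J ^ 1 := by simpa using hx
  rwa [hψ.cc_right_one hJ (hJ.inG_oneAdd le_rfl hx1) (hJ.inG_oneAdd (by omega) hz), one_mul] at h1

lemma gam_prod (hJ : NilAlg J) (hm : 1 ≤ m) (hψ : IChar J (m + 1) ψ) {a b z : R}
    (ha : a ∈ J) (hb : b ∈ J) (hz : z ∈ J ^ m) : gam ψ (a * b) z = 1 := by
  have ha1 : a ∈ J ^ 1 := by simpa using ha
  have hb1 : b ∈ J ^ 1 := by simpa using hb
  have hab : a * b ∈ J := hJ.mul (Submodule.mul_mem_mul ha hb)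
  have h1 := hψ.cc_key hJ hm hab hz
  have hbz : b * z ∈ J ^ (m + 1) := hJ.mul_mem_of hb1 hz (by omega) (by omega)
  have hza : z * a ∈ J ^ (m + 1) := hJ.mul_mem_of hz ha1 (by omega) (by omega)
  have h2 := hψ.cyc hJ hm ha hbz
  have h3 := hψ.cyc hJ hm hb hza
  rw [← mul_assoc] at h2 h3
  have hA : InG J (m + 1) (oneAdd (z * (a * b))) := hJ.inG_oneAdd (by omega)
    (by rw [← mul_assoc]; exact hJ.mul_mem_of hza hb1 (by omega) (by omega))
  rw [← h2, ← h3, mul_assoc] at h1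
  exact (mul_eq_right₀ (hψ.ne_zero hJ (by omega) hA)).mp h1

lemma cc_eq_gam (hJ : NilAlg J) {g h : Rˣ} (hg : InG J 1 g) (hm : 1 ≤ m) (hh : InG J m h) :
    cc ψ g h = gam ψ (g - 1) (h - 1) := by
  have e1 : oneAdd ((g : R) - 1) = g := Units.ext (by
    rw [hJ.coe_oneAdd (hg.mem hJ le_rfl)]; abel)
  have e2 : oneAdd ((h : R) - 1) = h := Units.ext (by
    rw [hJ.coe_oneAdd (hh.mem hJ hm)]; abel)
  rw [gam, e1, e2]

lemma gam_add_sq (hJ : NilAlg J) (hm : 1 ≤ m) (hψ : IChar J (m + 1) ψ) {x' z : R}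
    (hx' : x' ∈ J ^ 2) (hz : z ∈ J ^ m) : ∀ x ∈ J, gam ψ (x + x') z = gam ψ x z := by
  have hz' := hJ.inG_oneAdd hm hz
  rw [pow_two] at hx'
  suffices h : x' ∈ J ∧ ∀ x ∈ J, gam ψ (x + x') z = gam ψ x z from h.2
  refine Submodule.mul_induction_on hx' ?_ ?_
  · intro a ha b hb
    refine ⟨hJ.mul (Submodule.mul_mem_mul ha hb), fun x hx => ?_⟩
    have hx1 : x ∈ J ^ 1 := by simpa using hx
    have ha1 : a ∈ J ^ 1 := by simpa using ha
    have hu : InG J 1 (oneAdd x) := hJ.inG_oneAdd le_rfl hx1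
    have ha' : ↑(oneAdd x)⁻¹ * a ∈ J := by
      simpa using InG.mul_mem_left hJ le_rfl ha1 (hu.inv hJ le_rfl)
    have hab : ↑(oneAdd x)⁻¹ * a * b ∈ J := hJ.mul (Submodule.mul_mem_mul ha' hb)
    have e : oneAdd (x + a * b) = oneAdd x * oneAdd (↑(oneAdd x)⁻¹ * a * b) := by
      apply Units.ext
      push_cast
      rw [hJ.coe_oneAdd hab, hJ.coe_oneAdd (add_mem hx (hJ.mul (Submodule.mul_mem_mul ha hb))),
        mul_add, mul_assoc, Units.mul_inv_cancel_left, hJ.coe_oneAdd hx, mul_one, add_assoc]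
    unfold gam
    rw [e, hψ.cc_mul_left hJ hm hu (hJ.inG_oneAdd le_rfl (by simpa using hab)) hz']
    have := hψ.gam_prod hJ hm ha' hb hz
    unfold gam at this
    rw [this, mul_one]
  · rintro a b ⟨ha, ha'⟩ ⟨hb, hb'⟩
    refine ⟨add_mem ha hb, fun x hx => ?_⟩
    rw [← add_assoc, hb' _ (add_mem hx ha), ha' x hx]

lemma gam_congr_left (hJ : NilAlg J) (hm : 1 ≤ m) (hψ : IChar J (m + 1) ψ) {x x' z : R}
    (hx : x ∈ J) (h : x' - x ∈ J ^ 2) (hz : z ∈ J ^ m) : gam ψ x' z = gam ψ x z := by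
  have := hψ.gam_add_sq hJ hm h hz x hx
  rwa [add_sub_cancel] at this

lemma gam_congr_right (hJ : NilAlg J) (hm : 1 ≤ m) (hψ : IChar J (m + 1) ψ) {x z z' : R}
    (hx : x ∈ J) (hz : z ∈ J ^ m) (h : z' - z ∈ J ^ (m + 1)) : gam ψ x z' = gam ψ x z := by
  have hz' : z' ∈ J ^ m := by
    have := add_mem hz (hJ.pow_le hm (by omega) h)
    rwa [add_sub_cancel] at this
  apply hψ.cc_congr_right hJ hm (hJ.inG_oneAdd le_rfl (by simpa using hx)) (hJ.inG_oneAdd hm hz)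
  rw [hJ.coe_oneAdd (hJ.mem_one hm hz), hJ.coe_oneAdd (hJ.mem_one hm hz')]
  simpa using h

lemma gam_add_left (hJ : NilAlg J) (hm : 1 ≤ m) (hψ : IChar J (m + 1) ψ) {x x' z : R}
    (hx : x ∈ J) (hx' : x' ∈ J) (hz : z ∈ J ^ m) :
    gam ψ (x + x') z = gam ψ x z * gam ψ x' z := by
  have h1 : InG J 1 (oneAdd x) := hJ.inG_oneAdd le_rfl (by simpa using hx)
  have h2 : InG J 1 (oneAdd x') := hJ.inG_oneAdd le_rfl (by simpa using hx')
  unfold gam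
  rw [← hψ.cc_mul_left hJ hm h1 h2 (hJ.inG_oneAdd hm hz),
    cc_eq_gam hJ (h1.mul hJ le_rfl h2) hm (hJ.inG_oneAdd hm hz), hJ.coe_oneAdd (hJ.mem_one hm hz)]
  have e : ((oneAdd x * oneAdd x' : Rˣ) : R) - 1 = x + x' + x * x' := by
    push_cast
    rw [hJ.coe_oneAdd hx, hJ.coe_oneAdd hx']; noncomm_ring
  rw [e, add_sub_cancel_left]
  exact (hψ.gam_add_sq hJ hm (by rw [pow_two]; exact Submodule.mul_mem_mul hx hx') hz _
    (add_mem hx hx')).symm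

lemma gam_add_right (hJ : NilAlg J) (hm : 1 ≤ m) (hψ : IChar J (m + 1) ψ) {x z z' : R}
    (hx : x ∈ J) (hz : z ∈ J ^ m) (hz' : z' ∈ J ^ m) :
    gam ψ x (z + z') = gam ψ x z * gam ψ x z' := by
  have h1 : InG J 1 (oneAdd x) := hJ.inG_oneAdd le_rfl (by simpa using hx)
  have h2 := hJ.inG_oneAdd hm hz
  have h3 := hJ.inG_oneAdd hm hz'
  unfold gam
  rw [← hψ.cc_mul_right hJ hm h1 h2 h3]
  symm
  apply hψ.cc_congr_right hJ hm h1 (hJ.inG_oneAdd hm (add_mem hz hz'))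
  have e : ((oneAdd z * oneAdd z' : Rˣ) : R) - oneAdd (z + z') = z * z' := by
    push_cast
    rw [hJ.coe_oneAdd (hJ.mem_one hm hz), hJ.coe_oneAdd (hJ.mem_one hm hz'),
      hJ.coe_oneAdd (hJ.mem_one hm (add_mem hz hz'))]
    noncomm_ring
  rw [e]
  exact hJ.mul_mem_of hz hz' (by omega) (by omega)

lemma gam_ne_zero (hJ : NilAlg J) (hm : 1 ≤ m) (hψ : IChar J (m + 1) ψ) {x z : R}
    (hx : x ∈ J) (hz : z ∈ J ^ m) : gam ψ x z ≠ 0 :=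
  hψ.ne_zero hJ (by omega) (InG.comm hJ hm (hJ.inG_oneAdd le_rfl (by simpa using hx))
    (hJ.inG_oneAdd hm hz))

lemma gam_zero_right (hJ : NilAlg J) (hm : 1 ≤ m) (hψ : IChar J (m + 1) ψ) {x : R}
    (hx : x ∈ J) : gam ψ x 0 = 1 := by
  have := hψ.gam_add_right hJ hm hx (zero_mem (J ^ m)) (zero_mem (J ^ m))
  rw [add_zero] at this
  exact (mul_eq_left₀ (hψ.gam_ne_zero hJ hm hx (zero_mem _))).mp this.symm

lemma gam_neg_right (hJ : NilAlg J) (hm : 1 ≤ m) (hψ : IChar J (m + 1) ψ) {x z : R}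
    (hx : x ∈ J) (hz : z ∈ J ^ m) : gam ψ x z * gam ψ x (-z) = 1 := by
  rw [← hψ.gam_add_right hJ hm hx hz (neg_mem hz), add_neg_cancel, hψ.gam_zero_right hJ hm hx]

lemma gam_sq_one (hJ : NilAlg J) (h2 : (2 : F) ≠ 0) (hm : 1 ≤ m) (hψ : IChar J (m + 1) ψ) {x : R}
    (hx : x ∈ J) {z : R} (hz : z ∈ J ^ m)
    (h : ∀ a : F, gam ψ x (a • z) = gam ψ x (-(a • z))) : gam ψ x z = 1 := by
  have h1 := hψ.gam_neg_right hJ hm hx (Submodule.smul_mem _ (2⁻¹ : F) hz)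
  rw [← h, ← hψ.gam_add_right hJ hm hx (Submodule.smul_mem _ (2⁻¹ : F) hz)
    (Submodule.smul_mem _ (2⁻¹ : F) hz), ← add_smul] at h1
  have : (2⁻¹ + 2⁻¹ : F) = 1 := by field_simp; norm_num
  rwa [this, one_smul] at h1

end IChar
end AlgPart


section InvPart

set_option linter.unusedSectionVars false

variable {F R : Type*} [Field F] [Ring R] [Algebra F R] [Finite R]

/-- `σ` is an anti-involution of the unital algebra `R`. -/
structure AntiInv (σ : R →ₗ[F] R) : Prop where
  one : σ 1 = 1
  anti : ∀ x y, σ (x * y) = σ y * σ x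
  invol : ∀ x, σ (σ x) = x

/-- The automorphism `g ↦ σ(g)⁻¹`. -/
def tau {σ : R →ₗ[F] R} (hσ : AntiInv σ) : Rˣ →* Rˣ where
  toFun g := ⟨σ (g⁻¹ : Rˣ), σ g, by rw [← hσ.anti, Units.mul_inv, hσ.one],
    by rw [← hσ.anti, Units.inv_mul, hσ.one]⟩
  map_one' := Units.ext (by simp [hσ.one])
  map_mul' g h := Units.ext (by simp [hσ.anti])

variable {σ : R →ₗ[F] R} {J : Submodule F R}

lemma tau_coe (hσ : AntiInv σ) (g : Rˣ) : (tau hσ g : R) = σ (g⁻¹ : Rˣ) := rfl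

lemma tau_inv_coe (hσ : AntiInv σ) (g : Rˣ) : (((tau hσ g)⁻¹ : Rˣ) : R) = σ g := rfl

lemma tau_tau (hσ : AntiInv σ) (g : Rˣ) : tau hσ (tau hσ g) = g := by
  apply Units.ext
  rw [tau_coe, tau_inv_coe, hσ.invol]

lemma tau_eq_iff (hσ : AntiInv σ) (g : Rˣ) : tau hσ g = g ↔ (g : R) * σ g = 1 := by
  rw [← tau_inv_coe hσ, Units.mul_inv_eq_one, eq_comm, Units.ext_iff]

/-- The group `Sp(J, σ)`. -/
def SpG (hσ : AntiInv σ) (hJ : NilAlg J) : Subgroup Rˣ where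
  carrier := {g | InG J 1 g ∧ tau hσ g = g}
  mul_mem' := by
    rintro a b ⟨ha, ha'⟩ ⟨hb, hb'⟩
    exact ⟨ha.mul hJ le_rfl hb, by rw [map_mul, ha', hb']⟩
  one_mem' := ⟨InG.one, map_one _⟩
  inv_mem' := by
    rintro a ⟨ha, ha'⟩
    exact ⟨ha.inv hJ le_rfl, by rw [map_inv, ha']⟩

lemma mem_SpG (hσ : AntiInv σ) (hJ : NilAlg J) {g : Rˣ} :
    g ∈ SpG hσ hJ ↔ InG J 1 g ∧ tau hσ g = g := Iff.rfl

lemma sig_mem_pow (hσ : AntiInv σ) (hs : ∀ x ∈ J, σ x ∈ J) (k : ℕ) :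
    ∀ x ∈ J ^ k, σ x ∈ J ^ k := by
  induction k with
  | zero =>
    intro x hx
    rw [pow_zero, Submodule.mem_one] at hx ⊢
    obtain ⟨a, rfl⟩ := hx
    exact ⟨a, by rw [Algebra.algebraMap_eq_smul_one, map_smul, hσ.one]⟩
  | succ k ih =>
    intro x hx
    rw [pow_succ] at hx
    refine Submodule.mul_induction_on hx ?_ ?_
    · intro a ha b hb
      rw [hσ.anti, pow_succ']
      exact Submodule.mul_mem_mul (hs b hb) (ih a ha)
    · intro a b ha hb
      rw [map_add]
      exact add_mem ha hb

lemma InG.tau (hσ : AntiInv σ) (hJ : NilAlg J) (hs : ∀ x ∈ J, σ x ∈ J) {m : ℕ} (hm : 1 ≤ m)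
    {g : Rˣ} (hg : InG J m g) : InG J m (tau hσ g) := by
  have := sig_mem_pow hσ hs m _ (hg.inv hJ hm)
  rw [map_sub, hσ.one] at this
  exact this

/-- Cayley transform lift. -/
lemma exists_lift (hσ : AntiInv σ) (hJ : NilAlg J) (h2 : (2 : F) ≠ 0)
    {m : ℕ} (hm : 1 ≤ m) {z : R} (hz : z ∈ J ^ m) (hzσ : σ z = -z) :
    ∃ u ∈ SpG hσ hJ, InG J m u ∧ (u : R) - (1 + z) ∈ J ^ (m + 1) := by
  set y : R := (2⁻¹ : F) • z with hy
  have hym : y ∈ J ^ m := Submodule.smul_mem _ _ hz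
  have hyJ : y ∈ J := hJ.mem_one hm hym
  have hyσ : σ y = -y := by rw [hy, map_smul, hzσ, smul_neg]
  have hz2 : z = y + y := by
    rw [hy, ← add_smul]
    have : (2⁻¹ + 2⁻¹ : F) = 1 := by field_simp; norm_num
    rw [this, one_smul]
  have cp : (oneAdd y : R) = 1 + y := hJ.coe_oneAdd hyJ
  have cm : (oneAdd (-y) : R) = 1 + -y := hJ.coe_oneAdd (neg_mem hyJ)
  have hp : InG J m (oneAdd y) := hJ.inG_oneAdd hm hym
  have hq : InG J m (oneAdd (-y)) := hJ.inG_oneAdd hm (neg_mem hym)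
  have tp : tau hσ (oneAdd y) = (oneAdd (-y))⁻¹ := by
    rw [← inv_inj, inv_inv]
    apply Units.ext
    rw [tau_inv_coe, cp, cm, map_add, hσ.one, hyσ]
  have tm : tau hσ (oneAdd (-y)) = (oneAdd y)⁻¹ := by
    rw [← inv_inj, inv_inv]
    apply Units.ext
    rw [tau_inv_coe, cp, cm, map_add, hσ.one, map_neg, hyσ, neg_neg]
  have hcomm : oneAdd y * oneAdd (-y) = oneAdd (-y) * oneAdd y := by
    apply Units.ext
    push_cast
    rw [cp, cm]; noncomm_ring
  have hu : InG J m (oneAdd y * (oneAdd (-y))⁻¹) := hp.mul hJ hm (hq.inv hJ hm)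
  refine ⟨oneAdd y * (oneAdd (-y))⁻¹, ⟨hu.mono hJ le_rfl hm, ?_⟩, hu, ?_⟩
  · rw [map_mul, map_inv, tp, tm, inv_inv, inv_mul_eq_iff_eq_mul, ← mul_assoc, ← hcomm, mul_assoc,
      mul_inv_cancel, mul_one]
  · have : ((oneAdd y * (oneAdd (-y))⁻¹ : Rˣ) : R) - (1 + z) = (y * y + y * y) * ↑(oneAdd (-y))⁻¹ := by
      have h1 : (oneAdd (-y) : R) * ↑(oneAdd (-y))⁻¹ = 1 := Units.mul_inv _
      calc ((oneAdd y * (oneAdd (-y))⁻¹ : Rˣ) : R) - (1 + z)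
          = (1 + y) * ↑(oneAdd (-y))⁻¹ - (1 + (y + y)) * ((oneAdd (-y) : R) * ↑(oneAdd (-y))⁻¹) := by
            rw [h1, mul_one, ← hz2]; push_cast; rw [cp]
        _ = _ := by rw [cm]; noncomm_ring
    rw [this]
    have hyy : y * y ∈ J ^ (m + 1) := hJ.mul_mem_of hym hym (by omega) (by omega)
    exact InG.mul_mem_right hJ (by omega) (add_mem hyy hyy)
      ((hq.mono hJ le_rfl hm).inv hJ le_rfl)

lemma exists_lift_one (hσ : AntiInv σ) (hJ : NilAlg J) (h2 : (2 : F) ≠ 0)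
    (hs : ∀ x ∈ J, σ x ∈ J) (hsym : ∀ x ∈ J, σ x + x ∈ J ^ 2) {x : R} (hx : x ∈ J) :
    ∃ u ∈ SpG hσ hJ, (u : R) - 1 - x ∈ J ^ 2 := by
  have hy : (2⁻¹ : F) • (x - σ x) ∈ J ^ 1 := by
    rw [pow_one]; exact J.smul_mem _ (sub_mem hx (hs x hx))
  obtain ⟨u, hu, -, hu'⟩ := exists_lift hσ hJ h2 le_rfl hy (by
    rw [map_smul, map_sub, hσ.invol, ← smul_neg, neg_sub])
  refine ⟨u, hu, ?_⟩
  have e : (u : R) - 1 - x = ((u : R) - (1 + (2⁻¹ : F) • (x - σ x))) - (2⁻¹ : F) • (σ x + x) := by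
    have : x = (2⁻¹ : F) • x + (2⁻¹ : F) • x := by
      rw [← add_smul]
      have : (2⁻¹ + 2⁻¹ : F) = 1 := by field_simp; norm_num
      rw [this, one_smul]
    rw [smul_sub, smul_add]
    nth_rw 1 [this]
    abel
  rw [e]
  exact sub_mem hu' (Submodule.smul_mem _ _ (hsym x hx))

lemma exists_half [Fintype F] (hchar : ringChar F ≠ 2) (hJ : NilAlg J) :
    ∃ r : ℕ, ∀ g : Rˣ, InG J 1 g → g ^ (2 * r) = g := by
  obtain ⟨N, hN⟩ := hJ.nil
  set p := ringChar F with hp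
  haveI : CharP F p := ringChar.charP F
  have hprime : p.Prime := CharP.char_is_prime F p
  haveI : Fact p.Prime := ⟨hprime⟩
  rcases subsingleton_or_nontrivial R with hsub | hnt
  · exact ⟨0, fun g _ => Units.ext (Subsingleton.elim _ _)⟩
  haveI : CharP R p := charP_of_injective_algebraMap (algebraMap F R).injective p
  have hodd : Odd (p ^ N) := (hprime.odd_of_ne_two hchar).pow
  obtain ⟨s, hs⟩ := hodd
  refine ⟨s + 1, fun g hg => ?_⟩
  have hone : g ^ (p ^ N) = 1 := by
    apply Units.ext
    push_cast
    have e : (g : R) = 1 + (g - 1) := by abel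
    rw [e, add_pow_char_pow_of_commute _ _ (Commute.one_left _), one_pow]
    have hle : N ≤ p ^ N := (Nat.lt_pow_self hprime.one_lt).le
    have hx := Submodule.pow_mem_pow J (hg.mem hJ le_rfl) N
    rw [hN, Submodule.mem_bot] at hx
    rw [pow_eq_zero_of_le hle hx, add_zero]
  have : 2 * (s + 1) = p ^ N + 1 := by omega
  rw [this, pow_succ, hone, one_mul]

lemma IChar.pow (hJ : NilAlg J) {n : ℕ} (hn : 1 ≤ n) {ψ : Rˣ → ℂ} (hψ : IChar J n ψ) {g : Rˣ}
    (hg : InG J n g) (k : ℕ) : ψ (g ^ k) = ψ g ^ k := by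
  induction k with
  | zero => simp [hψ.one]
  | succ k ih => rw [pow_succ, hψ.mul _ _ (hg.pow hJ hn k) hg, ih, pow_succ]

/-- Extending the invariant character one step. -/
lemma extend_char (hσ : AntiInv σ) (hJ : NilAlg J) (h2 : (2 : F) ≠ 0)
    (hs : ∀ x ∈ J, σ x ∈ J) {r : ℕ} (hr : ∀ g : Rˣ, InG J 1 g → g ^ (2 * r) = g)
    {m : ℕ} (hm : 1 ≤ m) {ψ χ : Rˣ → ℂ} (hψ : IChar J (m + 1) ψ)
    (hτ : ∀ g, InG J (m + 1) g → ψ (tau hσ g) = ψ g)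
    (hcc : ∀ g h, InG J 1 g → InG J m h → cc ψ g h = 1)
    (hχmul : ∀ u ∈ SpG hσ hJ, ∀ v ∈ SpG hσ hJ, InG J m u → InG J m v → χ (u * v) = χ u * χ v)
    (hχψ : ∀ u ∈ SpG hσ hJ, InG J (m + 1) u → χ u = ψ u) :
    ∃ ψ' : Rˣ → ℂ, IChar J m ψ' ∧ (∀ g, InG J m g → ψ' (tau hσ g) = ψ' g) ∧
      ∀ u ∈ SpG hσ hJ, InG J m u → ψ' u = χ u := by
  classical
  have hm1 : 1 ≤ m + 1 := by omega
  have up : ∀ {g}, InG J (m + 1) g → InG J m g := fun h => h.mono hJ hm (by omega)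
  have to1 : ∀ {g}, InG J m g → InG J 1 g := fun h => h.mono hJ le_rfl hm
  have to1' : ∀ {g}, InG J (m + 1) g → InG J 1 g := fun h => h.mono hJ le_rfl hm1
  let D : Rˣ → Prop := fun d => ∃ u ∈ SpG hσ hJ, InG J m u ∧ InG J (m + 1) (u⁻¹ * d)
  let Ψ : Rˣ → ℂ := fun d => if h : D d then χ h.choose * ψ (h.choose⁻¹ * d) else 1
  have hΨ : ∀ u ∈ SpG hσ hJ, InG J m u → ∀ k, InG J (m + 1) k → Ψ (u * k) = χ u * ψ k := by
    intro u hu hum k hk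
    have hD : D (u * k) := ⟨u, hu, hum, by rwa [inv_mul_cancel_left]⟩
    obtain ⟨hv, hvm, hvk⟩ := hD.choose_spec
    simp only [Ψ, dif_pos hD]
    generalize hD.choose = v at *
    have e1 : v⁻¹ * u = (v⁻¹ * (u * k)) * k⁻¹ := by group
    have hvu : InG J (m + 1) (v⁻¹ * u) := by
      rw [e1]; exact hvk.mul hJ hm1 (hk.inv hJ hm1)
    have hvuS : v⁻¹ * u ∈ SpG hσ hJ := Subgroup.mul_mem _ (Subgroup.inv_mem _ hv) hu
    have e2 : u = v * (v⁻¹ * u) := by group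
    have e3 : χ u = χ v * ψ (v⁻¹ * u) := by
      conv_lhs => rw [e2]
      rw [hχmul _ hv _ hvuS hvm (up hvu), hχψ _ hvuS hvu]
    rw [e3, ← mul_assoc, hψ.mul _ _ hvu hk, mul_assoc]
  have hDe : ∀ d, D d → ∃ u ∈ SpG hσ hJ, InG J m u ∧ ∃ k, InG J (m + 1) k ∧ d = u * k := by
    rintro d ⟨u, hu, hum, hk⟩
    exact ⟨u, hu, hum, _, hk, by group⟩
  have hDm : ∀ d, D d → InG J m d := by
    intro d hd
    obtain ⟨u, hu, hum, k, hk, rfl⟩ := hDe d hd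
    exact hum.mul hJ hm (up hk)
  have hDi : ∀ u ∈ SpG hσ hJ, InG J m u → ∀ k, InG J (m + 1) k → D (u * k) := by
    intro u hu hum k hk
    exact ⟨u, hu, hum, by rwa [inv_mul_cancel_left]⟩
  have hDG : ∀ k, InG J (m + 1) k → D k := by
    intro k hk
    have := hDi 1 (Subgroup.one_mem _) InG.one k hk
    rwa [one_mul] at this
  have hχ1 : χ 1 = 1 := by rw [hχψ 1 (Subgroup.one_mem _) InG.one, hψ.one]
  have hΨψ : ∀ k, InG J (m + 1) k → Ψ k = ψ k := by
    intro k hk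
    have := hΨ 1 (Subgroup.one_mem _) InG.one k hk
    rwa [one_mul, hχ1, one_mul] at this
  have hΨχ : ∀ u ∈ SpG hσ hJ, InG J m u → Ψ u = χ u := by
    intro u hu hum
    have := hΨ u hu hum 1 InG.one
    rwa [mul_one, hψ.one, mul_one] at this
  have hmulaux : ∀ u v k l : Rˣ, u * k * (v * l) = (u * v) * ((v⁻¹ * k * v⁻¹⁻¹) * l) := by
    intro u v k l; group
  have hcj : ∀ {v k : Rˣ}, InG J m v → InG J (m + 1) k → InG J (m + 1) (v⁻¹ * k * v⁻¹⁻¹) :=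
    fun hv hk => hk.conj hJ hm1 ((to1 hv).inv hJ le_rfl)
  have hDmul : ∀ d d', D d → D d' → D (d * d') := by
    intro d d' hd hd'
    obtain ⟨u, hu, hum, k, hk, rfl⟩ := hDe d hd
    obtain ⟨v, hv, hvm, l, hl, rfl⟩ := hDe d' hd'
    rw [hmulaux]
    exact hDi _ (Subgroup.mul_mem _ hu hv) (hum.mul hJ hm hvm) _ ((hcj hvm hk).mul hJ hm1 hl)
  have hΨmul : ∀ d d', D d → D d' → Ψ (d * d') = Ψ d * Ψ d' := by
    intro d d' hd hd'
    obtain ⟨u, hu, hum, k, hk, rfl⟩ := hDe d hd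
    obtain ⟨v, hv, hvm, l, hl, rfl⟩ := hDe d' hd'
    rw [hmulaux, hΨ _ (Subgroup.mul_mem _ hu hv) (hum.mul hJ hm hvm) _
      ((hcj hvm hk).mul hJ hm1 hl), hΨ u hu hum k hk, hΨ v hv hvm l hl, hχmul _ hu _ hv hum hvm,
      hψ.mul _ _ (hcj hvm hk) hl, hψ.conj _ _ ((to1 hvm).inv hJ le_rfl) hk]
    ring
  have hΨconj : ∀ g d, InG J 1 g → D d → Ψ (g * d * g⁻¹) = Ψ d := by
    intro g d hg hd
    have e : g * d * g⁻¹ = (g * d * g⁻¹ * d⁻¹) * d := by group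
    have hc := hg.comm hJ hm (hDm d hd)
    rw [e, hΨmul _ _ (hDG _ hc) hd, hΨψ _ hc]
    have := hcc g d hg (hDm d hd)
    unfold cc at this
    rw [this, one_mul]
  -- `g τ(g) ∈ D`
  have hDτ : ∀ g, InG J m g → D (g * tau hσ g) := by
    intro g hg
    have hσz := sig_mem_pow hσ hs m _ hg
    obtain ⟨u, hu, hum, hud⟩ := exists_lift hσ hJ h2 hm (sub_mem hg hσz) (by
      rw [map_sub, hσ.invol, neg_sub])
    refine ⟨u, hu, hum, InG.ratio hJ hm1 (to1 hum) ?_⟩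
    set z : R := (g : R) - 1 with hz
    have hτ1 : InG J 1 (tau hσ g) := (to1 hg).tau hσ hJ hs le_rfl
    have hgz : (g : R) = 1 + z := by rw [hz]; abel
    have e1 : ((g * tau hσ g : Rˣ) : R) - (1 + (z - σ z)) =
        (-(z * σ z) + σ z * σ z) * (tau hσ g : R) := by
      have h1 : (((tau hσ g)⁻¹ : Rˣ) : R) * (tau hσ g : R) = 1 := Units.inv_mul _
      have h3 : (((tau hσ g)⁻¹ : Rˣ) : R) = 1 + σ z := by
        rw [tau_inv_coe, hgz, map_add, hσ.one]
      rw [h3] at h1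
      calc ((g * tau hσ g : Rˣ) : R) - (1 + (z - σ z))
          = (1 + z) * (tau hσ g : R) - (1 + (z - σ z)) * ((1 + σ z) * (tau hσ g : R)) := by
            rw [h1, mul_one]; push_cast; rw [← hgz]
        _ = _ := by noncomm_ring
    have e2 : ((g * tau hσ g : Rˣ) : R) - u =
        (((g * tau hσ g : Rˣ) : R) - (1 + (z - σ z))) - ((u : R) - (1 + (z - σ z))) := by abel
    rw [e2]
    refine sub_mem ?_ hud
    rw [e1]
    exact InG.mul_mem_right hJ hm1 (add_mem
      (neg_mem (hJ.mul_mem_of hg hσz hm1 (by omega)))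
      (hJ.mul_mem_of hσz hσz hm1 (by omega))) hτ1
  let ψ' : Rˣ → ℂ := fun g => Ψ (g * tau hσ g) ^ r
  have hψ'mul : ∀ g h, InG J m g → InG J m h → ψ' (g * h) = ψ' g * ψ' h := by
    intro g h hg hh
    have hτ1 : InG J 1 (tau hσ g)⁻¹ := ((to1 hg).tau hσ hJ hs le_rfl).inv hJ le_rfl
    have e : g * h * tau hσ (g * h) =
        (g * tau hσ g) * (((tau hσ g)⁻¹ * h * (tau hσ g)⁻¹⁻¹ * h⁻¹) * (h * tau hσ h)) := by
      rw [map_mul]; group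
    have hc := hτ1.comm hJ hm hh
    have h1 := hcc _ h hτ1 hh
    unfold cc at h1
    simp only [ψ']
    rw [e, hΨmul _ _ (hDτ g hg) (hDmul _ _ (hDG _ hc) (hDτ h hh)),
      hΨmul _ _ (hDG _ hc) (hDτ h hh), hΨψ _ hc, h1, one_mul, mul_pow]
  have hψ'ψ : ∀ g, InG J (m + 1) g → ψ' g = ψ g := by
    intro g hg
    simp only [ψ']
    have hτg := hg.tau hσ hJ hs hm1
    rw [hΨψ _ (hg.mul hJ hm1 hτg), hψ.mul _ _ hg hτg, hτ g hg, ← pow_two, ← pow_mul,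
      ← hψ.pow hJ hm1 hg, hr g (to1' hg)]
  have hχpow : ∀ u ∈ SpG hσ hJ, InG J m u → ∀ k, χ (u ^ k) = χ u ^ k := by
    intro u hu hum k
    induction k with
    | zero => simp [hχ1]
    | succ k ih =>
      rw [pow_succ, hχmul _ (Subgroup.pow_mem _ hu k) _ hu (hum.pow hJ hm k) hum, ih, pow_succ]
  refine ⟨ψ', ⟨?_, hψ'mul, ?_⟩, ?_, ?_⟩
  · rw [hψ'ψ 1 InG.one, hψ.one]
  · intro g a hg ha
    have e : g * a * g⁻¹ = (g * a * g⁻¹ * a⁻¹) * a := by group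
    have hc := hg.comm hJ hm ha
    have h1 := hcc g a hg ha
    unfold cc at h1
    rw [e, hψ'mul _ _ (up hc) ha, hψ'ψ _ hc, h1, one_mul]
  · intro a ha
    simp only [ψ']
    have e : tau hσ a * tau hσ (tau hσ a) = a⁻¹ * (a * tau hσ a) * a⁻¹⁻¹ := by
      rw [tau_tau]; group
    rw [e, hΨconj _ _ ((to1 ha).inv hJ le_rfl) (hDτ a ha)]
  · intro u hu hum
    simp only [ψ']
    rw [hu.2, ← pow_two, hΨχ _ (Subgroup.pow_mem _ hu 2) (hum.pow hJ hm 2), hχpow u hu hum,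
      ← pow_mul, ← hχpow u hu hum, hr u hu.1]

end InvPart


section MainPart

set_option linter.unusedSectionVars false

variable {F R : Type*} [Field F] [Fintype F] [Ring R] [Algebra F R] [Finite R]
variable {σ : R →ₗ[F] R} {J : Submodule F R}
variable {V : Type*} [AddCommGroup V] [Module ℂ V] [FiniteDimensional ℂ V]

lemma relIndex_pow (hσ : AntiInv σ) (hJ : NilAlg J) (h2 : (2 : F) ≠ 0)
    (hs : ∀ x ∈ J, σ x ∈ J) (hsym : ∀ x ∈ J, σ x + x ∈ J ^ 2) {B : Submodule F R}
    (hB : NilAlg B) (hBJ : B ≤ J) (hJB : J ^ 2 ≤ B) :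
    ∃ k, (SpG hσ hB).relIndex (SpG hσ hJ) = Fintype.card F ^ k := by
  let f : SpG hσ hJ →* Multiplicative (R ⧸ B) :=
    { toFun := fun u => Multiplicative.ofAdd (B.mkQ (((u : Rˣ) : R) - 1))
      map_one' := by simp
      map_mul' := by
        intro u v
        rw [← ofAdd_add, ← map_add]
        congr 1
        rw [← sub_eq_zero, ← map_sub, Submodule.mkQ_apply, Submodule.Quotient.mk_eq_zero]
        apply hJB
        have e : (((u * v : SpG hσ hJ) : Rˣ) : R) - 1 - ((((u : Rˣ) : R) - 1) + (((v : Rˣ) : R) - 1))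
            = (((u : Rˣ) : R) - 1) * (((v : Rˣ) : R) - 1) := by
          push_cast; noncomm_ring
        rw [e]
        exact NilAlg.mul_mem' (a := 1) (b := 1) u.2.1 v.2.1 }
  have hker : (SpG hσ hB).subgroupOf (SpG hσ hJ) = f.ker := by
    ext u
    rw [Subgroup.mem_subgroupOf, MonoidHom.mem_ker, mem_SpG]
    change _ ↔ Multiplicative.ofAdd (B.mkQ (((u : Rˣ) : R) - 1)) = Multiplicative.ofAdd 0
    rw [Multiplicative.ofAdd.apply_eq_iff_eq, Submodule.mkQ_apply, Submodule.Quotient.mk_eq_zero]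
    unfold InG
    rw [pow_one]
    exact ⟨fun h => h.1, fun h => ⟨h, u.2.2⟩⟩
  have hrange : (f.range : Set (Multiplicative (R ⧸ B))) =
      Multiplicative.toAdd ⁻¹' (J.map B.mkQ : Set (R ⧸ B)) := by
    ext y
    constructor
    · rintro ⟨u, rfl⟩
      exact ⟨((u : Rˣ) : R) - 1, u.2.1.mem hJ le_rfl, rfl⟩
    · rintro ⟨x, hx, hxy⟩
      obtain ⟨u, hu, hux⟩ := exists_lift_one hσ hJ h2 hs hsym hx
      refine ⟨⟨u, hu⟩, ?_⟩
      apply Multiplicative.toAdd.injective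
      rw [← hxy]
      change B.mkQ ((u : R) - 1) = B.mkQ x
      rw [← sub_eq_zero, ← map_sub, Submodule.mkQ_apply, Submodule.Quotient.mk_eq_zero]
      exact hJB hux
  refine ⟨Module.finrank F (J.map B.mkQ), ?_⟩
  rw [Subgroup.relIndex, hker, Subgroup.index_ker]
  have e1 : Nat.card f.range = Nat.card (J.map B.mkQ) := by
    have h3 : Nat.card f.range = (f.range : Set (Multiplicative (R ⧸ B))).ncard := rfl
    have h4 : Nat.card (J.map B.mkQ) = (J.map B.mkQ : Set (R ⧸ B)).ncard := rfl
    rw [h3, h4, hrange]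
    exact Set.ncard_preimage_of_injective_subset_range Multiplicative.toAdd.injective
      (by rw [Multiplicative.toAdd.surjective.range_eq]; exact Set.subset_univ _)
  rw [e1, Module.natCard_eq_pow_finrank (K := F), Nat.card_eq_fintype_card]

/-- The inductive situation: an invariant character of `1 + J ^ n` through which the subgroup
acts on `W`. -/
structure Stage (hσ : AntiInv σ) (hJ : NilAlg J) (ρ : Rˣ → V →ₗ[ℂ] V) (W : Submodule ℂ V)
    (n : ℕ) (ψ : Rˣ → ℂ) : Prop where
  ichar : IChar J n ψ
  tau_inv : ∀ g, InG J n g → ψ (tau hσ g) = ψ g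
  act : ∀ u ∈ SpG hσ hJ, InG J n u → ∀ w ∈ W, ρ u w = ψ u • w

lemma stage_down (hσ : AntiInv σ) (hJ : NilAlg J) (h2 : (2 : F) ≠ 0) (hchar : ringChar F ≠ 2)
    (hs : ∀ x ∈ J, σ x ∈ J) {ρ : Rˣ → V →ₗ[ℂ] V}
    (hρ : ∀ g ∈ SpG hσ hJ, ∀ h ∈ SpG hσ hJ, ρ (g * h) = ρ g ∘ₗ ρ h)
    {W : Submodule ℂ V} (hW : IrrOn ρ (SpG hσ hJ) W) {m : ℕ} (hm : 1 ≤ m) {ψ : Rˣ → ℂ}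
    (hst : Stage hσ hJ ρ W (m + 1) ψ)
    (hg : ∀ x ∈ J, ∀ z ∈ J ^ m, IChar.gam ψ x z = 1) :
    ∃ ψ', Stage hσ hJ ρ W m ψ' := by
  have hcc : ∀ g h, InG J 1 g → InG J m h → cc ψ g h = 1 := by
    intro g h hg1 hh
    rw [IChar.cc_eq_gam hJ hg1 hm hh]
    exact hg _ (hg1.mem hJ le_rfl) _ hh
  have hex : ∀ u, ∃ a : ℂ, u ∈ SpG hσ hJ → InG J m u → ∀ w ∈ W, ρ u w = a • w := by
    intro u
    by_cases hu : u ∈ SpG hσ hJ ∧ InG J m u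
    · obtain ⟨hu, hum⟩ := hu
      obtain ⟨a, ha⟩ := schur_on hW (ρ u) (hW.2.1 u hu) (by
        intro h hh w hw
        have hcm : h * u * h⁻¹ * u⁻¹ ∈ SpG hσ hJ :=
          Subgroup.mul_mem _ (Subgroup.mul_mem _ (Subgroup.mul_mem _ hh hu)
            (Subgroup.inv_mem _ hh)) (Subgroup.inv_mem _ hu)
        have e1 : ρ u (ρ h w) = ρ (u * h) w := by rw [hρ u hu h hh]; rfl
        have e2 : ρ h (ρ u w) = ρ (h * u) w := by rw [hρ h hh u hu]; rfl
        have e3 : h * u = (h * u * h⁻¹ * u⁻¹) * (u * h) := by group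
        rw [e1, e2, e3, hρ _ hcm _ (Subgroup.mul_mem _ hu hh), LinearMap.comp_apply,
          hst.act _ hcm (hh.1.comm hJ hm hum) _
            (hW.2.1 _ (Subgroup.mul_mem _ hu hh) w hw)]
        have := hcc h u hh.1 hum
        unfold cc at this
        rw [this, one_smul])
      exact ⟨a, fun _ _ => ha⟩
    · exact ⟨0, fun h1 h3 => absurd ⟨h1, h3⟩ hu⟩
  choose χ hχ using hex
  obtain ⟨w0, hw0, hw0'⟩ := W.ne_bot_iff.mp hW.1
  obtain ⟨r, hr⟩ := exists_half hchar hJ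
  obtain ⟨ψ', h3, h4, h5⟩ := extend_char hσ hJ h2 hs hr hm hst.ichar hst.tau_inv hcc (χ := χ) (by
      intro u hu v hv hum hvm
      have huv := Subgroup.mul_mem _ hu hv
      apply smul_left_injective ℂ hw0'
      change χ (u * v) • w0 = (χ u * χ v) • w0
      rw [← hχ _ huv (hum.mul hJ hm hvm) w0 hw0, hρ u hu v hv, LinearMap.comp_apply,
        hχ v hv hvm w0 hw0, map_smul, hχ u hu hum w0 hw0, smul_smul, mul_comm])
    (by
      intro u hu hum
      apply smul_left_injective ℂ hw0'
      change χ u • w0 = ψ u • w0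
      rw [← hχ u hu (hum.mono hJ hm (by omega)) w0 hw0, hst.act u hu hum w0 hw0])
  refine ⟨ψ', h3, h4, fun u hu hum w hw => ?_⟩
  rw [h5 u hu hum, hχ u hu hum w hw]

/-- `τ`-invariance of the pairing. -/
lemma gam_sig (hσ : AntiInv σ) (hJ : NilAlg J) (h2 : (2 : F) ≠ 0)
    (hs : ∀ x ∈ J, σ x ∈ J) (hsym : ∀ x ∈ J, σ x + x ∈ J ^ 2) {m : ℕ} (hm : 1 ≤ m) {ψ : Rˣ → ℂ}
    (hψ : IChar J (m + 1) ψ) (hτ : ∀ g, InG J (m + 1) g → ψ (tau hσ g) = ψ g)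
    {x z : R} (hx : x ∈ J) (hz : z ∈ J ^ m) : IChar.gam ψ x (-σ z) = IChar.gam ψ x z := by
  obtain ⟨u, hu, hux⟩ := exists_lift_one hσ hJ h2 hs hsym hx
  have hσz := sig_mem_pow hσ hs m z hz
  have hh := hJ.inG_oneAdd hm hz
  have hth := hh.tau hσ hJ hs hm
  have hu1 : (u : R) - 1 ∈ J := hu.1.mem hJ le_rfl
  have e1 : cc ψ u (tau hσ (oneAdd z)) = cc ψ u (oneAdd z) := by
    have := hτ _ (hu.1.comm hJ hm hh)
    simp only [map_mul, map_inv, hu.2] at this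
    exact this
  rw [IChar.cc_eq_gam hJ hu.1 hm hth, IChar.cc_eq_gam hJ hu.1 hm hh] at e1
  have cz : (oneAdd z : R) = 1 + z := hJ.coe_oneAdd (hJ.mem_one hm hz)
  have hxx : ∀ z ∈ J ^ m, IChar.gam ψ ((u : R) - 1) z = IChar.gam ψ x z :=
    fun z hz => hψ.gam_congr_left hJ hm hx hux hz
  rw [hxx _ hth, hxx _ hh, cz, add_sub_cancel_left] at e1
  rw [← e1]
  symm
  apply hψ.gam_congr_right hJ hm hx (neg_mem hσz)
  -- `τ(1+z) - 1 + σ z = σ z * (1 - τ)`-type identity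
  have h1 : (((tau hσ (oneAdd z))⁻¹ : Rˣ) : R) * (tau hσ (oneAdd z) : R) = 1 := Units.inv_mul _
  have h3 : (((tau hσ (oneAdd z))⁻¹ : Rˣ) : R) = 1 + σ z := by
    rw [tau_inv_coe, cz, map_add, hσ.one]
  rw [h3] at h1
  have e : (tau hσ (oneAdd z) : R) - 1 - -σ z = -(σ z * ((tau hσ (oneAdd z) : R) - 1)) := by
    have : (tau hσ (oneAdd z) : R) = 1 - σ z * (tau hσ (oneAdd z) : R) := by
      rw [← h1]; noncomm_ring
    rw [mul_sub, mul_one]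
    nth_rw 1 [this]
    abel
  rw [e]
  exact neg_mem (hJ.mul_mem_of hσz hth (by omega) (by omega))

/-- The codimension-one-type subalgebra. -/
def subB (hJ : NilAlg J) {m : ℕ} (hm : 1 ≤ m) {ψ : Rˣ → ℂ} (hψ : IChar J (m + 1) ψ) {z : R}
    (hz : z ∈ J ^ m) : Submodule F R where
  carrier := {x | x ∈ J ∧ ∀ a : F, IChar.gam ψ x (a • z) = 1}
  add_mem' := by
    rintro x y ⟨hx, hx'⟩ ⟨hy, hy'⟩
    refine ⟨add_mem hx hy, fun a => ?_⟩
    rw [hψ.gam_add_left hJ hm hx hy ((J ^ m).smul_mem a hz), hx' a, hy' a, one_mul]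
  zero_mem' := by
    refine ⟨zero_mem _, fun a => ?_⟩
    have haz := (J ^ m).smul_mem a hz
    have := hψ.gam_smul hJ hm (0 : F) (zero_mem J) haz
    rw [zero_smul, zero_smul, hψ.gam_zero_right hJ hm (zero_mem J)] at this
    exact this
  smul_mem' := by
    rintro b x ⟨hx, hx'⟩
    refine ⟨J.smul_mem b hx, fun a => ?_⟩
    rw [hψ.gam_smul hJ hm b hx ((J ^ m).smul_mem a hz), smul_smul, hx' (b * a)]

lemma mem_subB (hJ : NilAlg J) {m : ℕ} (hm : 1 ≤ m) {ψ : Rˣ → ℂ} (hψ : IChar J (m + 1) ψ) {z : R}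
    (hz : z ∈ J ^ m) {x : R} : x ∈ subB hJ hm hψ hz ↔ x ∈ J ∧ ∀ a : F, IChar.gam ψ x (a • z) = 1 :=
  Iff.rfl

lemma NilAlg.sub (hJ : NilAlg J) {B : Submodule F R} (hBJ : B ≤ J) (hJB : J ^ 2 ≤ B) :
    NilAlg B := by
  refine ⟨?_, ?_⟩
  · calc B * B ≤ J * J := mul_le_mul' hBJ hBJ
      _ = J ^ 2 := (pow_two J).symm
      _ ≤ B := hJB
  · obtain ⟨N, hN⟩ := hJ.nil
    exact ⟨N, le_bot_iff.mp (hN ▸ pow_le_pow_left' hBJ N)⟩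

lemma sigma_stable_of_sym (hsym : ∀ x ∈ J, σ x + x ∈ J ^ 2) {B : Submodule F R}
    (hBJ : B ≤ J) (hJB : J ^ 2 ≤ B) : ∀ x ∈ B, σ x ∈ B := by
  intro x hx
  have := sub_mem (hJB (hsym x (hBJ hx))) hx
  rwa [add_sub_cancel_right] at this

lemma step_down (hσ : AntiInv σ) (hJ : NilAlg J) (h2 : (2 : F) ≠ 0)
    (hs : ∀ x ∈ J, σ x ∈ J) (hsym : ∀ x ∈ J, σ x + x ∈ J ^ 2) {ρ : Rˣ → V →ₗ[ℂ] V}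
    (hρ1 : ρ 1 = LinearMap.id)
    (hρ : ∀ g ∈ SpG hσ hJ, ∀ h ∈ SpG hσ hJ, ρ (g * h) = ρ g ∘ₗ ρ h)
    {W : Submodule ℂ V} (hW : IrrOn ρ (SpG hσ hJ) W) {m : ℕ} (hm : 1 ≤ m) {ψ : Rˣ → ℂ}
    (hst : Stage hσ hJ ρ W (m + 1) ψ) {x0 z0 : R} (hx0 : x0 ∈ J) (hz0 : z0 ∈ J ^ m)
    (hne : IChar.gam ψ x0 z0 ≠ 1) :
    ∃ (B : Submodule F R) (hB : NilAlg B), B < J ∧ (∀ x ∈ B, σ x ∈ B) ∧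
      ∃ W0, IrrOn ρ (SpG hσ hB) W0 ∧
        ∃ k, Module.finrank ℂ W = Fintype.card F ^ k * Module.finrank ℂ W0 := by
  have hψ := hst.ichar
  have hσz0 := sig_mem_pow hσ hs m z0 hz0
  have half : (2⁻¹ + 2⁻¹ : F) = 1 := by field_simp; norm_num
  -- antisymmetrize
  obtain ⟨z, hz, hzσ, hzne⟩ : ∃ z ∈ J ^ m, σ z = -z ∧ IChar.gam ψ x0 z ≠ 1 := by
    have hA := (J ^ m).smul_mem (2⁻¹ : F) hz0
    have hB := sig_mem_pow hσ hs m _ hA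
    refine ⟨(2⁻¹ : F) • z0 + -σ ((2⁻¹ : F) • z0), add_mem hA (neg_mem hB), ?_, ?_⟩
    · rw [map_add, map_neg, hσ.invol]; abel
    · rw [hψ.gam_add_right hJ hm hx0 hA (neg_mem hB), gam_sig hσ hJ h2 hs hsym hm hψ hst.tau_inv hx0 hA,
        ← hψ.gam_add_right hJ hm hx0 hA hA, ← add_smul, half, one_smul]
      exact hne
  have hzz : ∀ a : F, a • z ∈ J ^ m := fun a => (J ^ m).smul_mem a hz
  set B := subB hJ hm hψ hz with hBdef
  have hBJ : B ≤ J := fun x hx => hx.1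
  have hJB : J ^ 2 ≤ B := by
    intro x hx
    refine ⟨hJ.mem_one (by omega) hx, fun a => ?_⟩
    have h0 := (zero_mem B : (0 : R) ∈ B).2 a
    rw [← h0]
    exact hψ.gam_congr_left hJ hm (zero_mem J) (by rwa [sub_zero]) (hzz a)
  have hB : NilAlg B := hJ.sub hBJ hJB
  have hx0B : x0 ∉ B := by
    intro h
    have := h.2 1
    rw [one_smul] at this
    exact hzne this
  have hlift : ∀ a : F, ∃ u ∈ SpG hσ hJ, InG J m u ∧ (u : R) - (1 + a • z) ∈ J ^ (m + 1) :=
    fun a => exists_lift hσ hJ h2 hm (hzz a) (by rw [map_smul, hzσ, smul_neg])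
  choose s hsS hsm hsd using hlift
  have hccs : ∀ h, InG J 1 h → ∀ a, cc ψ h (s a) = IChar.gam ψ ((h : R) - 1) (a • z) := by
    intro h hh a
    rw [IChar.cc_eq_gam hJ hh hm (hsm a)]
    apply hψ.gam_congr_right hJ hm (hh.mem hJ le_rfl) (hzz a)
    rw [sub_sub]; exact hsd a
  have hsB : ∀ a, (s a : R) - 1 ∈ B := by
    intro a
    rcases Nat.lt_or_ge 1 m with hm2 | hm2
    · exact hJB (hJ.pow_le (by omega) (by omega) (hsm a))
    · obtain rfl : m = 1 := by omega
      have haz : ∀ b : F, b • z ∈ J := fun b => by simpa using hzz b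
      have hzJ : z ∈ J := by simpa using hz
      have key : a • z ∈ B := by
        refine ⟨haz a, fun b => ?_⟩
        rw [hψ.gam_smul hJ hm a hzJ (hzz b)]
        -- gam z (c z) is symmetric and antisymmetric
        have anti : ∀ {x y : R}, x ∈ J → y ∈ J → IChar.gam ψ x y * IChar.gam ψ y x = 1 := by
          intro x y hx hy
          have hx1 : InG J 1 (oneAdd x) := hJ.inG_oneAdd le_rfl (by simpa using hx)
          have hy1 : InG J 1 (oneAdd y) := hJ.inG_oneAdd le_rfl (by simpa using hy)
          unfold IChar.gam cc
          rw [← hψ.mul _ _ (hx1.comm hJ le_rfl hy1) (hy1.comm hJ le_rfl hx1)]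
          have : oneAdd x * oneAdd y * (oneAdd x)⁻¹ * (oneAdd y)⁻¹ *
            (oneAdd y * oneAdd x * (oneAdd y)⁻¹ * (oneAdd x)⁻¹) = 1 := by group
          rw [this, hψ.one]
        rw [smul_smul]
        apply hψ.gam_sq_one hJ h2 hm hzJ (hzz _)
        intro c
        rw [smul_smul]
        set d := c * (a * b)
        have h3 := anti hzJ (haz d)
        rw [hψ.gam_smul hJ hm d hzJ hz] at h3
        have h4 := hψ.gam_neg_right hJ hm hzJ (hzz d)
        exact mul_left_cancel₀ (left_ne_zero_of_mul_eq_one h4) (h3.trans h4.symm)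
      have := add_mem (hJB (hsd a)) key
      have e : (s a : R) - (1 + a • z) + a • z = (s a : R) - 1 := by abel
      rwa [e] at this
  have hLH : SpG hσ hB ≤ SpG hσ hJ := by
    intro u hu
    refine ⟨?_, hu.2⟩
    have := hBJ (hu.1.mem hB le_rfl)
    unfold InG; rwa [pow_one]
  obtain ⟨W0, hW0, hirr, hdim⟩ := clifford_on hW hρ1 hρ hLH s
    (fun a => ⟨by have := hsB a; unfold InG; rwa [pow_one], (hsS a).2⟩)
    (fun h a => cc ψ h (s a))
    (fun g hg h hh a => hψ.cc_mul_left hJ hm hg.1 hh.1 (hsm a))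
    (by
      intro h hh a w hw
      have hcm : h * s a * h⁻¹ * (s a)⁻¹ ∈ SpG hσ hJ :=
          Subgroup.mul_mem _ (Subgroup.mul_mem _ (Subgroup.mul_mem _ hh (hsS a))
            (Subgroup.inv_mem _ hh)) (Subgroup.inv_mem _ (hsS a))
      have e : h * s a * h⁻¹ = (h * s a * h⁻¹ * (s a)⁻¹) * s a := by group
      rw [e, hρ _ hcm _ (hsS a), LinearMap.comp_apply,
        hst.act _ hcm (hh.1.comm hJ hm (hsm a)) _ (hW.2.1 _ (hsS a) w hw)]
      rfl)
    (by
      intro h hh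
      simp only [hccs h hh.1]
      constructor
      · intro h3
        refine ⟨?_, hh.2⟩
        unfold InG
        rw [pow_one]
        exact ⟨hh.1.mem hJ le_rfl, h3⟩
      · intro h3
        exact (h3.1.mem hB le_rfl).2)
  obtain ⟨k, hk⟩ := relIndex_pow hσ hJ h2 hs hsym hB hBJ hJB
  refine ⟨B, hB, lt_of_le_of_ne hBJ (fun h => hx0B (h ▸ hx0)), sigma_stable_of_sym hsym hBJ hJB,
    W0, hirr, k, ?_⟩
  rw [hdim, hk]

lemma stage_main (hσ : AntiInv σ) (hJ : NilAlg J) (h2 : (2 : F) ≠ 0) (hchar : ringChar F ≠ 2)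
    (hs : ∀ x ∈ J, σ x ∈ J) (hsym : ∀ x ∈ J, σ x + x ∈ J ^ 2) {ρ : Rˣ → V →ₗ[ℂ] V}
    (hρ1 : ρ 1 = LinearMap.id)
    (hρ : ∀ g ∈ SpG hσ hJ, ∀ h ∈ SpG hσ hJ, ρ (g * h) = ρ g ∘ₗ ρ h)
    {W : Submodule ℂ V} (hW : IrrOn ρ (SpG hσ hJ) W)
    (IH : ∀ (B : Submodule F R) (hB : NilAlg B), B < J → (∀ x ∈ B, σ x ∈ B) →
      ∀ W0, IrrOn ρ (SpG hσ hB) W0 → ∃ k, Module.finrank ℂ W0 = Fintype.card F ^ k)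
    (m : ℕ) : ∀ ψ, Stage hσ hJ ρ W (m + 1) ψ → ∃ k, Module.finrank ℂ W = Fintype.card F ^ k := by
  induction m with
  | zero =>
    intro ψ hst
    obtain ⟨w0, hw0, hw0'⟩ := W.ne_bot_iff.mp hW.1
    have hle : Submodule.span ℂ {w0} ≤ W := by
      rw [Submodule.span_singleton_le_iff_mem]; exact hw0
    rcases hW.2.2 (Submodule.span ℂ {w0}) hle (by
      intro h hh w hw
      rw [hst.act h hh hh.1 w (hle hw)]
      exact Submodule.smul_mem _ _ hw) with h | h
    · exact absurd (Submodule.span_singleton_eq_bot.mp h) hw0'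
    · exact ⟨0, by rw [← h, finrank_span_singleton hw0', pow_zero]⟩
  | succ m ih =>
    intro ψ hst
    by_cases hg : ∀ x ∈ J, ∀ z ∈ J ^ (m + 1), IChar.gam ψ x z = 1
    · obtain ⟨ψ', hst'⟩ := stage_down hσ hJ h2 hchar hs hρ hW (by omega) hst hg
      exact ih ψ' hst'
    · push Not at hg
      obtain ⟨x0, hx0, z0, hz0, hne⟩ := hg
      obtain ⟨B, hB, hlt, hBs, W0, hirr, k, hk⟩ :=
        step_down hσ hJ h2 hs hsym hρ1 hρ hW (by omega) hst hx0 hz0 hne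
      obtain ⟨l, hl⟩ := IH B hB hlt hBs W0 hirr
      exact ⟨k + l, by rw [hk, hl, pow_add]⟩

lemma main_ind (hσ : AntiInv σ) (h2 : (2 : F) ≠ 0) (hchar : ringChar F ≠ 2)
    {ρ : Rˣ → V →ₗ[ℂ] V} (hρ1 : ρ 1 = LinearMap.id) :
    ∀ (d : ℕ) (J : Submodule F R) (hJ : NilAlg J), (J : Set R).ncard = d → (∀ x ∈ J, σ x ∈ J) →
    (∀ g ∈ SpG hσ hJ, ∀ h ∈ SpG hσ hJ, ρ (g * h) = ρ g ∘ₗ ρ h) →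
    ∀ W : Submodule ℂ V, IrrOn ρ (SpG hσ hJ) W → ∃ k, Module.finrank ℂ W = Fintype.card F ^ k := by
  intro d
  induction d using Nat.strong_induction_on with
  | _ d ihd =>
  intro J hJ hd hs hρ W hW
  have IH : ∀ (B : Submodule F R) (hB : NilAlg B), B < J → (∀ x ∈ B, σ x ∈ B) →
      ∀ W0, IrrOn ρ (SpG hσ hB) W0 → ∃ k, Module.finrank ℂ W0 = Fintype.card F ^ k := by
    intro B hB hlt hBs W0 hW0
    have hLH : SpG hσ hB ≤ SpG hσ hJ := by
      intro u hu
      refine ⟨?_, hu.2⟩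
      have := hlt.le (hu.1.mem hB le_rfl)
      unfold InG; rwa [pow_one]
    refine ihd _ ?_ B hB rfl hBs (fun g hg h hh => hρ g (hLH hg) h (hLH hh)) W0 hW0
    rw [← hd]
    exact Set.ncard_lt_ncard (SetLike.coe_ssubset_coe.mpr hlt) (Set.toFinite _)
  by_cases hsym : ∀ x ∈ J, σ x + x ∈ J ^ 2
  · obtain ⟨N, hN⟩ := hJ.nil
    have hbot : J ^ (N + 1) = ⊥ := by rw [pow_succ, hN, Submodule.bot_mul]
    have hone : ∀ g, InG J (N + 1) g → g = 1 := by
      intro g hg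
      unfold InG at hg
      rw [hbot, Submodule.mem_bot, sub_eq_zero] at hg
      exact Units.ext hg
    refine stage_main hσ hJ h2 hchar hs hsym hρ1 hρ hW IH N (fun _ => 1) ⟨⟨rfl, ?_, ?_⟩, ?_, ?_⟩
    · intros; rw [one_mul]
    · intros; rfl
    · intros; rfl
    · intro u _ hu w _
      rw [hone u hu, hρ1, one_smul]; rfl
  · -- pass to the subalgebra generated by antisymmetric elements
    let B : Submodule F R :=
      { carrier := {x | x ∈ J ∧ σ x + x ∈ J ^ 2}
        add_mem' := by
          rintro x y ⟨hx, hx'⟩ ⟨hy, hy'⟩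
          refine ⟨add_mem hx hy, ?_⟩
          have := add_mem hx' hy'
          rw [map_add]
          convert this using 1
          abel
        zero_mem' := ⟨zero_mem _, by simp⟩
        smul_mem' := by
          rintro a x ⟨hx, hx'⟩
          refine ⟨J.smul_mem a hx, ?_⟩
          rw [map_smul, ← smul_add]
          exact Submodule.smul_mem _ _ hx' }
    have hBJ : B ≤ J := fun x hx => hx.1
    have hJB : J ^ 2 ≤ B := fun x hx =>
      ⟨hJ.mem_one (by omega) hx, add_mem (sig_mem_pow hσ hs 2 x hx) hx⟩
    have hB := hJ.sub hBJ hJB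
    have hne : B ≠ J := by
      intro h
      apply hsym
      intro x hx
      rw [← h] at hx
      exact hx.2
    have hEq : SpG hσ hB = SpG hσ hJ := by
      ext u
      constructor
      · intro hu
        refine ⟨?_, hu.2⟩
        have := hBJ (hu.1.mem hB le_rfl)
        unfold InG; rwa [pow_one]
      · intro hu
        refine ⟨?_, hu.2⟩
        have hx := hu.1.mem hJ le_rfl
        have h1 := (tau_eq_iff hσ u).mp hu.2
        unfold InG; rw [pow_one]
        refine ⟨hx, ?_⟩
        have e : σ ((u : R) - 1) + ((u : R) - 1) = -(((u : R) - 1) * σ ((u : R) - 1)) := by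
          rw [map_sub, hσ.one, sub_mul, mul_sub, h1]; noncomm_ring
        rw [e, pow_two]
        exact neg_mem (Submodule.mul_mem_mul hx (hs _ hx))
    refine IH B hB (lt_of_le_of_ne hBJ hne) ?_ W (by rw [hEq]; exact hW)
    rintro x ⟨hx, hx'⟩
    refine ⟨hs x hx, ?_⟩
    rw [hσ.invol, add_comm]; exact hx'

end MainPart

section FinalPart

variable {F : Type*} [Field F] {A : Type*} [NonUnitalRing A] [Module F A]
    [IsScalarTower F A A] [SMulCommClass F A A]

/-- The augmentation ideal. -/
def augJ (F A : Type*) [Field F] [NonUnitalRing A] [Module F A]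
    [IsScalarTower F A A] [SMulCommClass F A A] : Submodule F (Unitization F A) :=
  LinearMap.range (Unitization.inrHom F F A)

lemma mem_augJ {x : Unitization F A} : x ∈ augJ F A ↔ x.fst = 0 := by
  constructor
  · rintro ⟨a, rfl⟩
    simp
  · intro h
    refine ⟨x.snd, ?_⟩
    ext <;> simp [h]

lemma inr_nupow (a : A) (k : ℕ) :
    ((nupow a k : A) : Unitization F A) = (a : Unitization F A) ^ (k + 1) := by
  induction k with
  | zero => simp [nupow]
  | succ k ih => rw [nupow, Unitization.inr_mul, ih, pow_succ' _ (k + 1)]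

lemma augJ_nilAlg [Finite (Unitization F A)] (hnil : ∀ a : A, ∃ k : ℕ, nupow a k = 0) :
    NilAlg (augJ F A) := by
  have hn : ∀ x ∈ augJ F A, IsNilpotent x := by
    rintro x ⟨a, rfl⟩
    obtain ⟨k, hk⟩ := hnil a
    refine ⟨k + 1, ?_⟩
    change (a : Unitization F A) ^ (k + 1) = 0
    rw [← inr_nupow, hk, Unitization.inr_zero]
  refine ⟨?_, ?_⟩
  · rw [Submodule.mul_le]
    intro x hx y hy
    rw [mem_augJ] at *
    simp [hx]
  · have hle : ∀ x ∈ augJ F A, x ∈ Ideal.jacobson (⊥ : Ideal (Unitization F A)) := by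
      intro x hx
      rw [Ideal.mem_jacobson_iff]
      intro y
      have hyx : y * x ∈ augJ F A := by
        rw [mem_augJ] at *
        simp [hx]
      obtain ⟨u, hu⟩ := (hn _ hyx).isUnit_one_add
      refine ⟨(u⁻¹ : (Unitization F A)ˣ), ?_⟩
      rw [Ideal.mem_bot, sub_eq_zero, mul_assoc]
      have := Units.inv_mul u
      rw [hu, mul_add, mul_one, add_comm] at this
      exact this
    obtain ⟨N, hN⟩ := IsArtinianRing.isNilpotent_jacobson_bot (R := Unitization F A)
    refine ⟨N, ?_⟩
    have hk : ∀ k, ∀ x ∈ (augJ F A) ^ k,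
        x ∈ (Ideal.jacobson (⊥ : Ideal (Unitization F A))) ^ k := by
      intro k
      induction k with
      | zero => intro x _; rw [Submodule.pow_zero, Ideal.one_eq_top]; trivial
      | succ k ih =>
        intro x hx
        rw [Submodule.pow_succ] at hx ⊢
        refine Submodule.mul_induction_on hx ?_ ?_
        · intro a ha b hb
          exact Ideal.mul_mem_mul (ih a ha) (hle b hb)
        · intro a b ha hb
          exact add_mem ha hb
    rw [eq_bot_iff]
    intro x hx
    have := hk N x hx
    rw [hN] at this
    exact this

/-- Extension of `σ` to the unitization. -/
def sigR (σ : A →ₗ[F] A) : Unitization F A →ₗ[F] Unitization F A where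
  toFun x := Unitization.inl x.fst + ((σ x.snd : A) : Unitization F A)
  map_add' x y := by ext <;> simp
  map_smul' a x := by ext <;> simp

lemma sigR_anti {σ : A →ₗ[F] A} (hanti : ∀ x y : A, σ (x * y) = σ y * σ x)
    (hinvol : ∀ x : A, σ (σ x) = x) : AntiInv (sigR σ) where
  one := by ext <;> simp [sigR]
  anti x y := by
    ext
    · simp [sigR, mul_comm]
    · simp [sigR, hanti]; abel
  invol x := by ext <;> simp [sigR, hinvol]

lemma sigR_fst (σ : A →ₗ[F] A) (x : Unitization F A) : (sigR σ x).fst = x.fst := by simp [sigR]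

lemma sigR_snd (σ : A →ₗ[F] A) (x : Unitization F A) : (sigR σ x).snd = σ x.snd := by simp [sigR]

end FinalPart

/-- Let `A` be a finite-dimensional associative nilpotent algebra over a finite field `F`
of odd characteristic, `σ` an `F`-linear anti-involution of `A`, and `G ≅ A^×` the
algebra group.  Then `Sp(A,σ) = {x : x + σ(x) + x·σ(x) = 0}` is a subgroup of `A^×`, and
every irreducible complex representation of it has dimension a power of `q = |F|`. -/
theorem generalized_unipotent_symplectic_dims_are_powers_of_q
    (F : Type*) [Field F] [Fintype F] (hchar : ringChar F ≠ 2)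
    (A : Type*) [NonUnitalRing A] [Module F A]
    [IsScalarTower F A A] [SMulCommClass F A A] [FiniteDimensional F A]
    (hnil : ∀ a : A, ∃ k : ℕ, nupow a k = 0)
    (σ : A →ₗ[F] A)
    (hanti : ∀ x y : A, σ (x * y) = σ y * σ x)
    (hinvol : ∀ x : A, σ (σ x) = x)
    (G : Type*) [Group G] (e : G ≃ A)
    (he1 : e 1 = 0)
    (hemul : ∀ g h : G, e (g * h) = e g + e h + e g * e h) :
    (∃ H : Subgroup G, (H : Set G) = {g : G | e g + σ (e g) + e g * σ (e g) = 0}) ∧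
    ∀ H : Subgroup G, (H : Set G) = {g : G | e g + σ (e g) + e g * σ (e g) = 0} →
      ∀ (V : Type) [AddCommGroup V] [Module ℂ V] [FiniteDimensional ℂ V]
        (ρ : ↥H →* (V →ₗ[ℂ] V)), IsIrreducibleRep ρ →
        ∃ k : ℕ, Module.finrank ℂ V = Fintype.card F ^ k := by
  haveI : Finite A := Module.finite_of_finite F
  haveI : Finite (Unitization F A) := Finite.of_injective (fun x => (x.fst, x.snd)) (by
    intro x y h
    simp only [Prod.mk.injEq] at h
    exact Unitization.ext h.1 h.2)
  have h2 : (2 : F) ≠ 0 := Ring.two_ne_zero hchar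
  have hJ : NilAlg (augJ F A) := augJ_nilAlg hnil
  have hσ : AntiInv (sigR σ) := sigR_anti hanti hinvol
  have hs : ∀ x ∈ augJ F A, sigR σ x ∈ augJ F A := by
    intro x hx
    rw [mem_augJ] at *
    rw [sigR_fst, hx]
  let φ0 : G →* Unitization F A :=
    { toFun := fun g => 1 + ((e g : A) : Unitization F A)
      map_one' := by simp [he1]
      map_mul' := by
        intro g h
        rw [hemul, Unitization.inr_add, Unitization.inr_add, Unitization.inr_mul]
        noncomm_ring }
  let φ : G →* (Unitization F A)ˣ := φ0.toHomUnits
  have hφ : ∀ g, (φ g : Unitization F A) = 1 + ((e g : A) : Unitization F A) := fun g => rfl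
  have hφsnd : ∀ g, (φ g : Unitization F A).snd = e g := by
    intro g; rw [hφ]; simp
  have hmem : ∀ g, φ g ∈ SpG hσ hJ ↔ e g + σ (e g) + e g * σ (e g) = 0 := by
    intro g
    have h1 : InG (augJ F A) 1 (φ g) := by
      unfold InG
      rw [pow_one, mem_augJ, hφ]; simp
    have h3 : (φ g : Unitization F A) * sigR σ (φ g) =
        1 + ((e g + σ (e g) + e g * σ (e g) : A) : Unitization F A) := by
      rw [hφ]
      ext
      · simp [sigR]
      · simp [sigR]; abel
    rw [mem_SpG, tau_eq_iff, h3, add_eq_left]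
    constructor
    · intro h
      have := congrArg (fun x : Unitization F A => x.snd) h.2
      simpa using this
    · intro h
      exact ⟨h1, by rw [h, Unitization.inr_zero]⟩
  have hsurj : ∀ u ∈ SpG hσ hJ, ∃ g, φ g = u := by
    intro u hu
    have h1 := hu.1.mem hJ le_rfl
    rw [mem_augJ] at h1
    refine ⟨e.symm (u : Unitization F A).snd, Units.ext ?_⟩
    rw [hφ, Equiv.apply_symm_apply]
    ext
    · simp only [Unitization.fst_add, Unitization.fst_one, Unitization.fst_inr, add_zero]
      have h4 : (u : Unitization F A).fst - 1 = 0 := h1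
      linear_combination -h4
    · simp
  refine ⟨⟨(SpG hσ hJ).comap φ, ?_⟩, ?_⟩
  · ext g
    exact hmem g
  · intro H hH V _ _ _ ρ hρ
    have hHm : ∀ g, g ∈ H ↔ φ g ∈ SpG hσ hJ := by
      intro g
      rw [hmem, ← SetLike.mem_coe, hH]; rfl
    classical
    let ρ' : (Unitization F A)ˣ → V →ₗ[ℂ] V := fun u =>
      if h : e.symm (u : Unitization F A).snd ∈ H then ρ ⟨_, h⟩ else LinearMap.id
    have hρ' : ∀ g (h : g ∈ H), ρ' (φ g) = ρ ⟨g, h⟩ := by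
      intro g h
      have eg : e.symm (φ g : Unitization F A).snd = g := by rw [hφsnd, Equiv.symm_apply_apply]
      have h' : e.symm (φ g : Unitization F A).snd ∈ H := by rw [eg]; exact h
      simp only [ρ']
      rw [dif_pos h']
      congr 1
      exact Subtype.ext eg
    have hone : ρ' 1 = LinearMap.id := by
      have := hρ' 1 H.one_mem
      rw [map_one] at this
      rw [this]
      exact map_one ρ
    have hmul : ∀ g ∈ SpG hσ hJ, ∀ h ∈ SpG hσ hJ, ρ' (g * h) = ρ' g ∘ₗ ρ' h := by
      intro u hu v hv
      obtain ⟨g, rfl⟩ := hsurj u hu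
      obtain ⟨h, rfl⟩ := hsurj v hv
      have hg := (hHm g).mpr hu
      have hh := (hHm h).mpr hv
      rw [← map_mul, hρ' _ (H.mul_mem hg hh), hρ' g hg, hρ' h hh]
      exact map_mul ρ ⟨g, hg⟩ ⟨h, hh⟩
    have hirr : IrrOn ρ' (SpG hσ hJ) (⊤ : Submodule ℂ V) := by
      refine ⟨?_, fun _ _ _ _ => trivial, ?_⟩
      · obtain ⟨v, hv⟩ := hρ.1
        exact (Submodule.ne_bot_iff _).mpr ⟨v, trivial, hv⟩
      · intro W' _ hW'
        apply hρ.2 W'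
        rintro ⟨g, hg⟩ v hv
        rw [← hρ' g hg]
        exact hW' _ ((hHm g).mp hg) v hv
    obtain ⟨k, hk⟩ := main_ind hσ h2 hchar hone _ (augJ F A) hJ rfl hs hmul ⊤ hirr
    exact ⟨k, by rw [← hk, finrank_top]⟩
end
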